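/- arXiv:2303.01474 — 2 statements merged into one kernel-verified Lean document; each statement's English description precedes it below -/
import Mathlib

section
/- Suppose f(x,·) is concave and each g_i(x,·) is convex on ℝᵐ for all x ∈ X (X ⊆ ℝⁿ closed), f, g are twice continuously differentiable, x̄ is a boundary point of X and a local minimizer of V over X, and the restricted sup-compactness holds at x̄. Assume either: (a) MFCQ holds for the system g(x̄,y) ≤ 0 at every y ∈ S(x̄), and a stable CQ holds at every (x̄,ỹ,λ̃) with ỹ ∈ S(x̄), λ̃ ∈ Σ(x̄,ỹ) for the constraint system {(x,y,λ) : ∇_y L(x,y,λ) = 0, λ ≥ 0}; or (b) Robinson stability holds for F at some (x̄,y) with y ∈ S(x̄), a stable parametric CQ holds at every y ∈ S(x̄) for the parametric system g(x,·) ≤ 0, a stable CQ holds at every (x̄,ỹ,λ̃) with ỹ ∈ S(x̄), λ̃ ∈ Σ(x̄,ỹ) for the constraint system {(x,y,λ) : ∇_y L(x,y,λ) = 0, λ ≥ 0}, and ∪_{y ∈ S(x̄), λ ∈ Σ(x̄,y)} {∇²_{xy}L(x̄,y,λ)u : ∇²_{yy}L(x̄,y,λ)u = 0, −∇_y g(x̄,y)ᵀu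 ≥ 0, λᵀ∇_y g(x̄,y)ᵀu = 0} = {0}. Then there exist ȳ ∈ S(x̄), λ̄ ∈ Σ(x̄,ȳ) and ū ∈ ℝᵐ such that: 0 ∈ ∇_x L(x̄,ȳ,λ̄) + ∇²_{xy}L(x̄,ȳ,λ̄)ū + N_X(x̄); ∇_y L(x̄,ȳ,λ̄) = 0; ∇²_{yy}L(x̄,ȳ,λ̄)ū = 0; −∇_y g(x̄,ȳ)ᵀū − g(x̄,ȳ) ≥ 0, λ̄ ≥ 0, λ̄ᵀ(−∇_y g(x̄,ȳ)ᵀū − g(x̄,ȳ)) = 0; and −g(x̄,ȳ) ≥ 0, λ̄ᵀg(x̄,ȳ) = 0. -/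
open Filter Topology Metric RealInnerProductSpace

noncomputable section

/-- Feasible region of the parametric maximization problem. -/
def Feas {n m q : ℕ} (g : EuclideanSpace ℝ (Fin n) → EuclideanSpace ℝ (Fin m) → Fin q → ℝ)
    (x : EuclideanSpace ℝ (Fin n)) : Set (EuclideanSpace ℝ (Fin m)) :=
  {y | ∀ i, g x y i ≤ 0}

/-- Maximal value function (EReal valued; `sSup ∅ = ⊥ = -∞`). -/
def Vfun {n m q : ℕ} (f : EuclideanSpace ℝ (Fin n) → EuclideanSpace ℝ (Fin m) → ℝ)
    (g : EuclideanSpace ℝ (Fin n) → EuclideanSpace ℝ (Fin m) → Fin q → ℝ)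
    (x : EuclideanSpace ℝ (Fin n)) : EReal :=
  sSup ((fun y => (f x y : EReal)) '' Feas g x)

/-- Solution map of the parametric maximization problem. -/
def Sol {n m q : ℕ} (f : EuclideanSpace ℝ (Fin n) → EuclideanSpace ℝ (Fin m) → ℝ)
    (g : EuclideanSpace ℝ (Fin n) → EuclideanSpace ℝ (Fin m) → Fin q → ℝ)
    (x : EuclideanSpace ℝ (Fin n)) : Set (EuclideanSpace ℝ (Fin m)) :=
  {y ∈ Feas g x | (f x y : EReal) = Vfun f g x}

/-- Lagrangian `L(x,y,λ) = f(x,y) - λᵀ g(x,y)`. -/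
def Lag {n m q : ℕ} (f : EuclideanSpace ℝ (Fin n) → EuclideanSpace ℝ (Fin m) → ℝ)
    (g : EuclideanSpace ℝ (Fin n) → EuclideanSpace ℝ (Fin m) → Fin q → ℝ)
    (x : EuclideanSpace ℝ (Fin n)) (y : EuclideanSpace ℝ (Fin m)) (lam : Fin q → ℝ) : ℝ :=
  f x y - ∑ i, lam i * g x y i

/-- Partial gradient in `x`. -/
def gradx {n m : ℕ} (φ : EuclideanSpace ℝ (Fin n) → EuclideanSpace ℝ (Fin m) → ℝ)
    (x : EuclideanSpace ℝ (Fin n)) (y : EuclideanSpace ℝ (Fin m)) : EuclideanSpace ℝ (Fin n) :=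
  gradient (fun x' => φ x' y) x

/-- Partial gradient in `y`. -/
def grady {n m : ℕ} (φ : EuclideanSpace ℝ (Fin n) → EuclideanSpace ℝ (Fin m) → ℝ)
    (x : EuclideanSpace ℝ (Fin n)) (y : EuclideanSpace ℝ (Fin m)) : EuclideanSpace ℝ (Fin m) :=
  gradient (fun y' => φ x y') y

/-- `∇_y L(x,y,λ)`. -/
def gradyL {n m q : ℕ} (f : EuclideanSpace ℝ (Fin n) → EuclideanSpace ℝ (Fin m) → ℝ)
    (g : EuclideanSpace ℝ (Fin n) → EuclideanSpace ℝ (Fin m) → Fin q → ℝ)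
    (x : EuclideanSpace ℝ (Fin n)) (y : EuclideanSpace ℝ (Fin m)) (lam : Fin q → ℝ) :
    EuclideanSpace ℝ (Fin m) :=
  grady (fun x y => Lag f g x y lam) x y

/-- `∇_x L(x,y,λ)`. -/
def gradxL {n m q : ℕ} (f : EuclideanSpace ℝ (Fin n) → EuclideanSpace ℝ (Fin m) → ℝ)
    (g : EuclideanSpace ℝ (Fin n) → EuclideanSpace ℝ (Fin m) → Fin q → ℝ)
    (x : EuclideanSpace ℝ (Fin n)) (y : EuclideanSpace ℝ (Fin m)) (lam : Fin q → ℝ) :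
    EuclideanSpace ℝ (Fin n) :=
  gradx (fun x y => Lag f g x y lam) x y

/-- `∇_y g(x,y)ᵀ u ∈ ℝ^q`. -/
def gyTu {n m q : ℕ} (g : EuclideanSpace ℝ (Fin n) → EuclideanSpace ℝ (Fin m) → Fin q → ℝ)
    (x : EuclideanSpace ℝ (Fin n)) (y : EuclideanSpace ℝ (Fin m)) (u : EuclideanSpace ℝ (Fin m)) :
    Fin q → ℝ :=
  fun i => ⟪grady (fun x y => g x y i) x y, u⟫

/-- `∇²_{yy} L(x,y,λ) u`. -/
def hessyyLu {n m q : ℕ} (f : EuclideanSpace ℝ (Fin n) → EuclideanSpace ℝ (Fin m) → ℝ)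
    (g : EuclideanSpace ℝ (Fin n) → EuclideanSpace ℝ (Fin m) → Fin q → ℝ)
    (x : EuclideanSpace ℝ (Fin n)) (y : EuclideanSpace ℝ (Fin m)) (lam : Fin q → ℝ)
    (u : EuclideanSpace ℝ (Fin m)) : EuclideanSpace ℝ (Fin m) :=
  gradient (fun y' => ⟪gradyL f g x y' lam, u⟫) y

/-- `∇²_{xy} L(x,y,λ) u ∈ ℝⁿ` (for `u ∈ ℝᵐ`). -/
def hessxyLu {n m q : ℕ} (f : EuclideanSpace ℝ (Fin n) → EuclideanSpace ℝ (Fin m) → ℝ)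
    (g : EuclideanSpace ℝ (Fin n) → EuclideanSpace ℝ (Fin m) → Fin q → ℝ)
    (x : EuclideanSpace ℝ (Fin n)) (y : EuclideanSpace ℝ (Fin m)) (lam : Fin q → ℝ)
    (u : EuclideanSpace ℝ (Fin m)) : EuclideanSpace ℝ (Fin n) :=
  gradient (fun x' => ⟪gradyL f g x' y lam, u⟫) x

/-- Multiplier set `Σ(x,y)`. -/
def SigmaSet {n m q : ℕ} (f : EuclideanSpace ℝ (Fin n) → EuclideanSpace ℝ (Fin m) → ℝ)
    (g : EuclideanSpace ℝ (Fin n) → EuclideanSpace ℝ (Fin m) → Fin q → ℝ)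
    (x : EuclideanSpace ℝ (Fin n)) (y : EuclideanSpace ℝ (Fin m)) : Set (Fin q → ℝ) :=
  {lam | gradyL f g x y lam = 0 ∧ (∀ i, 0 ≤ lam i) ∧ (∀ i, g x y i ≤ 0) ∧
    ∑ i, lam i * g x y i = 0}

/-- Singular multiplier set `Σ⁰(x,y)`. -/
def SigmaZero {n m q : ℕ} (g : EuclideanSpace ℝ (Fin n) → EuclideanSpace ℝ (Fin m) → Fin q → ℝ)
    (x : EuclideanSpace ℝ (Fin n)) (y : EuclideanSpace ℝ (Fin m)) : Set (Fin q → ℝ) :=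
  {lam | ∑ i, lam i • grady (fun x y => g x y i) x y = 0 ∧ (∀ i, 0 ≤ lam i) ∧
    (∀ i, g x y i ≤ 0) ∧ ∑ i, lam i * g x y i = 0}

/-- The set `Ξ^r(x,y,λ)`. -/
def XiSet {n m q : ℕ} (r : ℝ) (f : EuclideanSpace ℝ (Fin n) → EuclideanSpace ℝ (Fin m) → ℝ)
    (g : EuclideanSpace ℝ (Fin n) → EuclideanSpace ℝ (Fin m) → Fin q → ℝ)
    (x : EuclideanSpace ℝ (Fin n)) (y : EuclideanSpace ℝ (Fin m)) (lam : Fin q → ℝ) :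
    Set (EuclideanSpace ℝ (Fin m)) :=
  {u | hessyyLu f g x y lam u = 0 ∧ (∀ i, 0 ≤ -(gyTu g x y u i) - r * g x y i) ∧
    (∀ i, 0 ≤ lam i) ∧ ∑ i, lam i * (-(gyTu g x y u i) - r * g x y i) = 0}

/-- Fréchet (regular) subdifferential of an `EReal` valued function. -/
def FSub {n : ℕ} (φ : EuclideanSpace ℝ (Fin n) → EReal) (x₀ : EuclideanSpace ℝ (Fin n)) :
    Set (EuclideanSpace ℝ (Fin n)) :=
  {v | ∃ c : ℝ, φ x₀ = (c : EReal) ∧ ∀ ε : ℝ, 0 < ε → ∃ δ : ℝ, 0 < δ ∧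
    ∀ x, ‖x - x₀‖ < δ → ((c + ⟪v, x - x₀⟫ - ε * ‖x - x₀‖ : ℝ) : EReal) ≤ φ x}

/-- Limiting (Mordukhovich) subdifferential. -/
def LSub {n : ℕ} (φ : EuclideanSpace ℝ (Fin n) → EReal) (x₀ : EuclideanSpace ℝ (Fin n)) :
    Set (EuclideanSpace ℝ (Fin n)) :=
  {v | ∃ (xk : ℕ → EuclideanSpace ℝ (Fin n)) (vk : ℕ → EuclideanSpace ℝ (Fin n)),
    (∀ k, vk k ∈ FSub φ (xk k)) ∧ Tendsto xk atTop (𝓝 x₀) ∧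
    Tendsto (fun k => φ (xk k)) atTop (𝓝 (φ x₀)) ∧ Tendsto vk atTop (𝓝 v)}

/-- Horizon (singular) subdifferential. -/
def HorSub {n : ℕ} (φ : EuclideanSpace ℝ (Fin n) → EReal) (x₀ : EuclideanSpace ℝ (Fin n)) :
    Set (EuclideanSpace ℝ (Fin n)) :=
  {v | ∃ (xk : ℕ → EuclideanSpace ℝ (Fin n)) (vk : ℕ → EuclideanSpace ℝ (Fin n)) (tk : ℕ → ℝ),
    (∀ k, vk k ∈ FSub φ (xk k)) ∧ (∀ k, 0 < tk k) ∧ Tendsto tk atTop (𝓝 0) ∧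
    Tendsto xk atTop (𝓝 x₀) ∧ Tendsto (fun k => φ (xk k)) atTop (𝓝 (φ x₀)) ∧
    Tendsto (fun k => tk k • vk k) atTop (𝓝 v)}

/-- Clarke subdifferential (for locally Lipschitz functions): convex hull of the limiting one. -/
def CSub {n : ℕ} (φ : EuclideanSpace ℝ (Fin n) → EReal) (x₀ : EuclideanSpace ℝ (Fin n)) :
    Set (EuclideanSpace ℝ (Fin n)) :=
  convexHull ℝ (LSub φ x₀)

/-- `φ` is (finite-valued and) Lipschitz continuous near `x₀`. -/
def LipschitzNearAt {n : ℕ} (φ : EuclideanSpace ℝ (Fin n) → EReal)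
    (x₀ : EuclideanSpace ℝ (Fin n)) : Prop :=
  ∃ δ : ℝ, 0 < δ ∧ ∃ K : NNReal, ∃ ψ : EuclideanSpace ℝ (Fin n) → ℝ,
    LipschitzWith K ψ ∧ ∀ x ∈ ball x₀ δ, φ x = (ψ x : EReal)

/-- Regular (Fréchet) normal cone. -/
def regNC {n : ℕ} (C : Set (EuclideanSpace ℝ (Fin n))) (x₀ : EuclideanSpace ℝ (Fin n)) :
    Set (EuclideanSpace ℝ (Fin n)) :=
  {ξ | ∀ ε : ℝ, 0 < ε → ∃ δ : ℝ, 0 < δ ∧ ∀ x ∈ C, ‖x - x₀‖ < δ →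
    ⟪ξ, x - x₀⟫ ≤ ε * ‖x - x₀‖}

/-- Limiting (Mordukhovich) normal cone. -/
def limNC {n : ℕ} (C : Set (EuclideanSpace ℝ (Fin n))) (x₀ : EuclideanSpace ℝ (Fin n)) :
    Set (EuclideanSpace ℝ (Fin n)) :=
  {ξ | ∃ (xk : ℕ → EuclideanSpace ℝ (Fin n)) (ξk : ℕ → EuclideanSpace ℝ (Fin n)),
    (∀ k, xk k ∈ C) ∧ (∀ k, ξk k ∈ regNC C (xk k)) ∧
    Tendsto xk atTop (𝓝 x₀) ∧ Tendsto ξk atTop (𝓝 ξ)}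

/-- Inner semicontinuity of the solution map at `(x̄, ȳ)`. -/
def InnerSemicont {n m q : ℕ} (f : EuclideanSpace ℝ (Fin n) → EuclideanSpace ℝ (Fin m) → ℝ)
    (g : EuclideanSpace ℝ (Fin n) → EuclideanSpace ℝ (Fin m) → Fin q → ℝ)
    (xb : EuclideanSpace ℝ (Fin n)) (yb : EuclideanSpace ℝ (Fin m)) : Prop :=
  ∀ xk : ℕ → EuclideanSpace ℝ (Fin n), Tendsto xk atTop (𝓝 xb) →
    ∃ yk : ℕ → EuclideanSpace ℝ (Fin m), (∀ k, yk k ∈ Sol f g (xk k)) ∧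
      Tendsto yk atTop (𝓝 yb)

/-- Local error bound for the system `g(x,y) ≤ 0` at `(x̄, ȳ)`. -/
def LocalErrorBound {n m q : ℕ}
    (g : EuclideanSpace ℝ (Fin n) → EuclideanSpace ℝ (Fin m) → Fin q → ℝ)
    (xb : EuclideanSpace ℝ (Fin n)) (yb : EuclideanSpace ℝ (Fin m)) : Prop :=
  ∃ κ δ : ℝ, 0 < κ ∧ 0 < δ ∧
    ∀ x y, ‖((x, y) : EuclideanSpace ℝ (Fin n) × EuclideanSpace ℝ (Fin m)) - (xb, yb)‖ < δ →
      Metric.infDist ((x, y) : EuclideanSpace ℝ (Fin n) × EuclideanSpace ℝ (Fin m))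
          {p : EuclideanSpace ℝ (Fin n) × EuclideanSpace ℝ (Fin m) | ∀ i, g p.1 p.2 i ≤ 0}
        ≤ κ * ∑ i, max (g x y i) 0

/-- MFCQ for the system `g(x̄, ·) ≤ 0` at `ȳ`. -/
def MFCQy {n m q : ℕ} (g : EuclideanSpace ℝ (Fin n) → EuclideanSpace ℝ (Fin m) → Fin q → ℝ)
    (xb : EuclideanSpace ℝ (Fin n)) (yb : EuclideanSpace ℝ (Fin m)) : Prop :=
  ∀ lam : Fin q → ℝ, (∀ i, 0 ≤ lam i) → (∑ i, lam i * g xb yb i = 0) →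
    (∀ i, g xb yb i ≤ 0) → (∑ i, lam i • grady (fun x y => g x y i) xb yb = 0) → lam = 0

/-- Restricted sup-compactness at `x̄`. -/
def RestrictedSupCompact {n m q : ℕ}
    (f : EuclideanSpace ℝ (Fin n) → EuclideanSpace ℝ (Fin m) → ℝ)
    (g : EuclideanSpace ℝ (Fin n) → EuclideanSpace ℝ (Fin m) → Fin q → ℝ)
    (xb : EuclideanSpace ℝ (Fin n)) : Prop :=
  (∃ c : ℝ, Vfun f g xb = (c : EReal)) ∧
  ∃ ε δ : ℝ, 0 < ε ∧ 0 < δ ∧ ∃ Ω : Set (EuclideanSpace ℝ (Fin m)), IsCompact Ω ∧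
    ∀ x, ‖x - xb‖ < δ → Vfun f g xb - (ε : EReal) < Vfun f g x → (Sol f g x ∩ Ω).Nonempty

/-- Robinson stability of the feasible map at `(x̄, ȳ)`. -/
def RobinsonStability {n m q : ℕ}
    (g : EuclideanSpace ℝ (Fin n) → EuclideanSpace ℝ (Fin m) → Fin q → ℝ)
    (xb : EuclideanSpace ℝ (Fin n)) (yb : EuclideanSpace ℝ (Fin m)) : Prop :=
  ∃ κ δ : ℝ, 0 < κ ∧ 0 < δ ∧
    ∀ x y, ‖((x, y) : EuclideanSpace ℝ (Fin n) × EuclideanSpace ℝ (Fin m)) - (xb, yb)‖ < δ →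
      Metric.infDist y (Feas g x) ≤ κ * ∑ i, max (g x y i) 0

/-- A constraint qualification holds at the feasible point `w₀` of the system
`{w : G w ≤ 0, H w = 0}`: local minimizers of C¹ functions over the feasible set
satisfy the KKT conditions. -/
def CQAt {W : Type} [NormedAddCommGroup W] [NormedSpace ℝ W] {p p' : ℕ}
    (G : W → Fin p → ℝ) (H : W → Fin p' → ℝ) (w₀ : W) : Prop :=
  ∀ θ : W → ℝ, ContDiff ℝ 1 θ →
    IsLocalMinOn θ {w | (∀ i, G w i ≤ 0) ∧ ∀ j, H w j = 0} w₀ →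
    ∃ (lam : Fin p → ℝ) (mu : Fin p' → ℝ), (∀ i, 0 ≤ lam i) ∧
      (fderiv ℝ θ w₀ + ∑ i, lam i • fderiv ℝ (fun w => G w i) w₀ +
        ∑ j, mu j • fderiv ℝ (fun w => H w j) w₀ = 0) ∧
      ∑ i, lam i * G w₀ i = 0

/-- Inequality constraints of the Wolfe dual system (`λ ≥ 0`). -/
def WolfeG (n m q : ℕ) :
    (EuclideanSpace ℝ (Fin n) × EuclideanSpace ℝ (Fin m) × (Fin q → ℝ)) → Fin q → ℝ :=
  fun w i => -(w.2.2 i)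

/-- Equality constraints of the Wolfe dual system (`∇_y L(x,y,λ) = 0`). -/
def WolfeH {n m q : ℕ} (f : EuclideanSpace ℝ (Fin n) → EuclideanSpace ℝ (Fin m) → ℝ)
    (g : EuclideanSpace ℝ (Fin n) → EuclideanSpace ℝ (Fin m) → Fin q → ℝ) :
    (EuclideanSpace ℝ (Fin n) × EuclideanSpace ℝ (Fin m) × (Fin q → ℝ)) → Fin m → ℝ :=
  fun w j => gradyL f g w.1 w.2.1 w.2.2 j

/-- The multiplier set `M(β, x, y)` of the parametric program. -/
def MultSetP {n m q : ℕ} (g : EuclideanSpace ℝ (Fin n) → EuclideanSpace ℝ (Fin m) → Fin q → ℝ)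
    (β : EuclideanSpace ℝ (Fin m)) (x : EuclideanSpace ℝ (Fin n))
    (y : EuclideanSpace ℝ (Fin m)) : Set (Fin q → ℝ) :=
  {lam | β - ∑ i, lam i • grady (fun x y => g x y i) x y = 0 ∧ (∀ i, 0 ≤ lam i) ∧
    ∑ i, lam i * g x y i = 0 ∧ ∀ i, g x y i ≤ 0}

/-- A stable parametric CQ holds at `ȳ ∈ F(x̄)` for the parametric system `g(x,·) ≤ 0`. -/
def StableParamCQ {n m q : ℕ} (f : EuclideanSpace ℝ (Fin n) → EuclideanSpace ℝ (Fin m) → ℝ)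
    (g : EuclideanSpace ℝ (Fin n) → EuclideanSpace ℝ (Fin m) → Fin q → ℝ)
    (xb : EuclideanSpace ℝ (Fin n)) (yb : EuclideanSpace ℝ (Fin m)) : Prop :=
  ∃ P : EuclideanSpace ℝ (Fin n) → EuclideanSpace ℝ (Fin m) → Prop,
    (∃ δ : ℝ, 0 < δ ∧ ∀ x y, y ∈ Feas g x → ‖x - xb‖ < δ → ‖y - yb‖ < δ → P x y) ∧
    (∀ x y, P x y → y ∈ Feas g x → IsLocalMaxOn (f x) (Feas g x) y →
      (MultSetP g (grady f x y) x y).Nonempty) ∧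
    (∀ (βk : ℕ → EuclideanSpace ℝ (Fin m)) (xk : ℕ → EuclideanSpace ℝ (Fin n))
        (yk : ℕ → EuclideanSpace ℝ (Fin m)) (βb : EuclideanSpace ℝ (Fin m)),
      Tendsto βk atTop (𝓝 βb) → Tendsto xk atTop (𝓝 xb) → Tendsto yk atTop (𝓝 yb) →
      (∀ k, (MultSetP g (βk k) (xk k) (yk k)).Nonempty) →
      ∃ (lamk : ℕ → Fin q → ℝ) (φ : ℕ → ℕ) (lamb : Fin q → ℝ),
        StrictMono φ ∧ (∀ k, lamk k ∈ MultSetP g (βk k) (xk k) (yk k)) ∧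
        Tendsto (lamk ∘ φ) atTop (𝓝 lamb) ∧ lamb ∈ MultSetP g βb xb yb)

/-- The multiplier set `M(β, w)` of a (nonparametric) system `{w : G w ≤ 0, H w = 0}`. -/
def MultSetW {W : Type} [NormedAddCommGroup W] [NormedSpace ℝ W] {p p' : ℕ}
    (G : W → Fin p → ℝ) (H : W → Fin p' → ℝ) (β : W →L[ℝ] ℝ) (w : W) :
    Set ((Fin p → ℝ) × (Fin p' → ℝ)) :=
  {lm | (∀ i, 0 ≤ lm.1 i) ∧
    (β - ∑ i, lm.1 i • fderiv ℝ (fun w => G w i) w -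
      ∑ j, lm.2 j • fderiv ℝ (fun w => H w j) w = 0) ∧
    ∑ i, lm.1 i * G w i = 0}

/-- A stable CQ holds at the feasible point `w̄` of the system `{w : G w ≤ 0, H w = 0}`. -/
def StableCQ {W : Type} [NormedAddCommGroup W] [NormedSpace ℝ W] {p p' : ℕ}
    (G : W → Fin p → ℝ) (H : W → Fin p' → ℝ) (wb : W) : Prop :=
  ∃ P : W → Prop,
    (P wb ∧ ∃ δ : ℝ, 0 < δ ∧ ∀ w, (∀ i, G w i ≤ 0) → (∀ j, H w j = 0) → ‖w - wb‖ < δ → P w) ∧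
    (∀ w, P w → (∀ i, G w i ≤ 0) → (∀ j, H w j = 0) →
      ∀ θ : W → ℝ, ContDiff ℝ 1 θ →
        IsLocalMinOn θ {w' | (∀ i, G w' i ≤ 0) ∧ ∀ j, H w' j = 0} w →
        ∃ (lam : Fin p → ℝ) (mu : Fin p' → ℝ), (∀ i, 0 ≤ lam i) ∧
          (fderiv ℝ θ w + ∑ i, lam i • fderiv ℝ (fun w => G w i) w +
            ∑ j, mu j • fderiv ℝ (fun w => H w j) w = 0) ∧
          ∑ i, lam i * G w i = 0) ∧
    (∀ (βk : ℕ → W →L[ℝ] ℝ) (wk : ℕ → W) (βb : W →L[ℝ] ℝ),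
      Tendsto βk atTop (𝓝 βb) → Tendsto wk atTop (𝓝 wb) →
      (∀ k, (∀ i, G (wk k) i ≤ 0) ∧ ∀ j, H (wk k) j = 0) →
      (∀ k, (MultSetW G H (βk k) (wk k)).Nonempty) →
      ∃ (lmk : ℕ → (Fin p → ℝ) × (Fin p' → ℝ)) (φ : ℕ → ℕ) (lmb : (Fin p → ℝ) × (Fin p' → ℝ)),
        StrictMono φ ∧ (∀ k, lmk k ∈ MultSetW G H (βk k) (wk k)) ∧
        Tendsto (lmk ∘ φ) atTop (𝓝 lmb) ∧ lmb ∈ MultSetW G H βb wb)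

/-- Critical cone of `(P_x̄)` at `y` associated with the multiplier `λ`. -/
def CritCone {n m q : ℕ} (g : EuclideanSpace ℝ (Fin n) → EuclideanSpace ℝ (Fin m) → Fin q → ℝ)
    (xb : EuclideanSpace ℝ (Fin n)) (y : EuclideanSpace ℝ (Fin m)) (lam : Fin q → ℝ) :
    Set (EuclideanSpace ℝ (Fin m)) :=
  {d | ∀ i, g xb y i = 0 →
    (0 < lam i → ⟪grady (fun x y => g x y i) xb y, d⟫ = 0) ∧
    (lam i = 0 → ⟪grady (fun x y => g x y i) xb y, d⟫ ≤ 0)}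

/-- Second order sufficient condition at `(y, λ)` for `(P_x̄)`. -/
def SOSC {n m q : ℕ} (f : EuclideanSpace ℝ (Fin n) → EuclideanSpace ℝ (Fin m) → ℝ)
    (g : EuclideanSpace ℝ (Fin n) → EuclideanSpace ℝ (Fin m) → Fin q → ℝ)
    (xb : EuclideanSpace ℝ (Fin n)) (y : EuclideanSpace ℝ (Fin m)) (lam : Fin q → ℝ) : Prop :=
  ∀ d ∈ CritCone g xb y lam, d ≠ 0 → ⟪d, hessyyLu f g xb y lam d⟫ < 0

/-- `(x̄, ȳ)` is a local solution of the minimax problem in the sense of Stackelberg. -/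
def StackelbergLocal {n m q : ℕ} (f : EuclideanSpace ℝ (Fin n) → EuclideanSpace ℝ (Fin m) → ℝ)
    (g : EuclideanSpace ℝ (Fin n) → EuclideanSpace ℝ (Fin m) → Fin q → ℝ)
    (X : Set (EuclideanSpace ℝ (Fin n))) (xb : EuclideanSpace ℝ (Fin n))
    (yb : EuclideanSpace ℝ (Fin m)) : Prop :=
  xb ∈ X ∧ yb ∈ Sol f g xb ∧ IsLocalMinOn (Vfun f g) X xb

/-- Feasible region of the MPEC reformulation `(P_MPEC)`. -/
def MPECFeas {n m q : ℕ} (f : EuclideanSpace ℝ (Fin n) → EuclideanSpace ℝ (Fin m) → ℝ)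
    (g : EuclideanSpace ℝ (Fin n) → EuclideanSpace ℝ (Fin m) → Fin q → ℝ)
    (X : Set (EuclideanSpace ℝ (Fin n))) :
    Set (EuclideanSpace ℝ (Fin n) × EuclideanSpace ℝ (Fin m) × (Fin q → ℝ)) :=
  {w | w.1 ∈ X ∧ gradyL f g w.1 w.2.1 w.2.2 = 0 ∧ (∀ i, g w.1 w.2.1 i ≤ 0) ∧
    (∀ i, 0 ≤ w.2.2 i) ∧ ∑ i, w.2.2 i * g w.1 w.2.1 i = 0}

/-- S-stationarity for `(P_MPEC)`. -/
def SStationary {n m q : ℕ} (f : EuclideanSpace ℝ (Fin n) → EuclideanSpace ℝ (Fin m) → ℝ)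
    (g : EuclideanSpace ℝ (Fin n) → EuclideanSpace ℝ (Fin m) → Fin q → ℝ)
    (X : Set (EuclideanSpace ℝ (Fin n))) (xb : EuclideanSpace ℝ (Fin n))
    (yb : EuclideanSpace ℝ (Fin m)) (lamb : Fin q → ℝ) : Prop :=
  ∃ (u : EuclideanSpace ℝ (Fin m)) (α β : Fin q → ℝ),
    -(gradx f xb yb + ∑ i, α i • gradx (fun x y => g x y i) xb yb +
        hessxyLu f g xb yb lamb u) ∈ limNC X xb ∧
    grady f xb yb + ∑ i, α i • grady (fun x y => g x y i) xb yb +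
      hessyyLu f g xb yb lamb u = 0 ∧
    (∀ i, -(gyTu g xb yb u i) - β i = 0) ∧
    (∀ i, g xb yb i < 0 → lamb i = 0 → α i = 0) ∧
    (∀ i, g xb yb i = 0 → 0 < lamb i → β i = 0) ∧
    (∀ i, g xb yb i = 0 → lamb i = 0 → 0 ≤ α i ∧ 0 ≤ β i)


/-- Optimal value function of the Wolfe dual (`sInf ∅ = ⊤`). -/
def VD {n m q : ℕ} (f : EuclideanSpace ℝ (Fin n) → EuclideanSpace ℝ (Fin m) → ℝ)
    (g : EuclideanSpace ℝ (Fin n) → EuclideanSpace ℝ (Fin m) → Fin q → ℝ)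
    (x : EuclideanSpace ℝ (Fin n)) : EReal :=
  sInf ((fun p : EuclideanSpace ℝ (Fin m) × (Fin q → ℝ) => (Lag f g x p.1 p.2 : EReal)) ''
    {p | gradyL f g x p.1 p.2 = 0 ∧ ∀ i, 0 ≤ p.2 i})

/-- Strict differentiability of an `EReal`-valued function at `x₀` with gradient `ζ`. -/
def StrictDiffAt {n : ℕ} (φ : EuclideanSpace ℝ (Fin n) → EReal)
    (x₀ ζ : EuclideanSpace ℝ (Fin n)) : Prop :=
  ∀ ε : ℝ, 0 < ε → ∃ δ : ℝ, 0 < δ ∧ ∀ x x', ‖x - x₀‖ < δ → ‖x' - x₀‖ < δ →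
    ∃ a b : ℝ, φ x = (a : EReal) ∧ φ x' = (b : EReal) ∧
      |a - b - ⟪ζ, x - x'⟫| ≤ ε * ‖x - x'‖

/-- `f` and `g` are separable with respect to `x` and `y`. -/
def SeparableFG {n m q : ℕ} (f : EuclideanSpace ℝ (Fin n) → EuclideanSpace ℝ (Fin m) → ℝ)
    (g : EuclideanSpace ℝ (Fin n) → EuclideanSpace ℝ (Fin m) → Fin q → ℝ) : Prop :=
  ∃ (f₁ : EuclideanSpace ℝ (Fin n) → ℝ) (f₂ : EuclideanSpace ℝ (Fin m) → ℝ)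
    (g₁ : EuclideanSpace ℝ (Fin n) → Fin q → ℝ) (g₂ : EuclideanSpace ℝ (Fin m) → Fin q → ℝ),
    (∀ x y, f x y = f₁ x + f₂ y) ∧ ∀ x y i, g x y i = g₁ x i + g₂ y i

end

/-! ### Auxiliary facts on normal cones and concave maximization -/

theorem limNC_of_eventually {n : ℕ} {C : Set (EuclideanSpace ℝ (Fin n))}
    {x₀ ξ : EuclideanSpace ℝ (Fin n)} {xk ξk : ℕ → EuclideanSpace ℝ (Fin n)}
    (hC : ∀ᶠ k in atTop, xk k ∈ C) (hN : ∀ᶠ k in atTop, ξk k ∈ regNC C (xk k))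
    (hx : Tendsto xk atTop (𝓝 x₀)) (hξ : Tendsto ξk atTop (𝓝 ξ)) : ξ ∈ limNC C x₀ := by
  obtain ⟨N, hN⟩ := eventually_atTop.1 (hC.and hN)
  refine ⟨fun k => xk (k + N), fun k => ξk (k + N), fun k => (hN _ (by omega)).1,
    fun k => (hN _ (by omega)).2, ?_, ?_⟩
  · exact hx.comp (tendsto_add_atTop_nat N)
  · exact hξ.comp (tendsto_add_atTop_nat N)

theorem regNC_smul {n : ℕ} {C : Set (EuclideanSpace ℝ (Fin n))}
    {x₀ ξ : EuclideanSpace ℝ (Fin n)} (h : ξ ∈ regNC C x₀) {c : ℝ} (hc : 0 < c) :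
    c • ξ ∈ regNC C x₀ := by
  intro ε hε
  obtain ⟨δ, hδ, H⟩ := h (ε / c) (by positivity)
  refine ⟨δ, hδ, fun x hx hxd => ?_⟩
  have h1 := mul_le_mul_of_nonneg_left (H x hx hxd) hc.le
  rw [real_inner_smul_left]
  refine h1.trans (le_of_eq ?_)
  field_simp

/-- If `x₀` locally minimizes `max_{y ∈ Y} φ(x, y)` over `X` and the inner maximizer at `x₀` is
unique, then minus the partial gradient of `φ` is a regular normal. -/
theorem neg_mem_regNC_of_unique_max {n : ℕ} {F : Type*} [NormedAddCommGroup F] [NormedSpace ℝ F]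
    {X : Set (EuclideanSpace ℝ (Fin n))} {Y : Set F} (hY : IsCompact Y)
    {φ : EuclideanSpace ℝ (Fin n) × F → ℝ} (hφc : Continuous φ)
    {x₀ v : EuclideanSpace ℝ (Fin n)} {y₀ : F}
    {φ' : EuclideanSpace ℝ (Fin n) × F →L[ℝ] ℝ} (hφ : HasStrictFDerivAt φ φ' (x₀, y₀))
    (hv : ∀ d, φ' (d, 0) = ⟪v, d⟫)
    (huniq : ∀ y ∈ Y, y ≠ y₀ → φ (x₀, y) < φ (x₀, y₀))
    (hmin : ∀ᶠ x in 𝓝[X] x₀, ∃ y ∈ Y, φ (x₀, y₀) ≤ φ (x, y)) :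
    -v ∈ regNC X x₀ := by
  intro ε hε
  have hlit := hφ.isLittleO.def hε
  rw [nhds_prod_eq] at hlit
  obtain ⟨U, hU, V, hV, hUV⟩ := Filter.mem_prod_iff.1 hlit
  obtain ⟨r₁, hr₁, hb₁⟩ := Metric.mem_nhds_iff.1 hU
  obtain ⟨r₂, hr₂, hb₂⟩ := Metric.mem_nhds_iff.1 hV
  set r := min r₁ r₂ with hr
  have hrpos : 0 < r := lt_min hr₁ hr₂
  have hK : IsCompact (Y \ ball y₀ r) := hY.diff isOpen_ball
  have hfar : ∀ᶠ x in 𝓝 x₀, ∀ y ∈ Y \ ball y₀ r, φ (x, y) < φ (x₀, y₀) := by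
    refine hK.eventually_forall_of_forall_eventually ?_
    intro y hy
    have hlt : φ (x₀, y) < φ (x₀, y₀) := huniq y hy.1 (by
      rintro rfl; exact hy.2 (mem_ball_self hrpos))
    exact (hφc.tendsto (x₀, y)).eventually (gt_mem_nhds hlt)
  have hall : ∀ᶠ x in 𝓝 x₀, x ∈ X → ∃ y ∈ Y, φ (x₀, y₀) ≤ φ (x, y) :=
    eventually_nhdsWithin_iff.1 hmin
  obtain ⟨δ, hδ, H⟩ := Metric.eventually_nhds_iff.1 (hfar.and hall)
  refine ⟨min δ r, lt_min hδ hrpos, fun x hx hxd => ?_⟩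
  have hxd' : dist x x₀ < min δ r := by rwa [dist_eq_norm]
  obtain ⟨h1, h2⟩ := H (hxd'.trans_le (min_le_left _ _))
  obtain ⟨y, hyY, hy⟩ := h2 hx
  have hyr : dist y y₀ < r := by
    by_contra hcon
    exact absurd hy (not_le.2 (h1 y ⟨hyY, fun h => hcon h⟩))
  have hxr : dist x x₀ < r := hxd'.trans_le (min_le_right _ _)
  have hm : (((x, y), (x₀, y)) : (EuclideanSpace ℝ (Fin n) × F) × EuclideanSpace ℝ (Fin n) × F)
      ∈ U ×ˢ V := by
    refine ⟨hb₁ ?_, hb₂ ?_⟩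
    · rw [mem_ball, Prod.dist_eq]
      exact max_lt (hxr.trans_le (min_le_left _ _)) (hyr.trans_le (min_le_left _ _))
    · rw [mem_ball, Prod.dist_eq]
      exact max_lt (by simpa using hr₂) (hyr.trans_le (min_le_right _ _))
  have h3 := hUV hm
  simp only [Set.mem_ofPred_eq, Prod.mk_sub_mk, sub_self, hv, Prod.norm_mk, norm_zero] at h3
  rw [max_eq_left (norm_nonneg _)] at h3
  have h4 : φ (x₀, y) ≤ φ (x₀, y₀) := by
    by_cases h : y = y₀
    · rw [h]
    · exact (huniq y hyY h).le
  have h5 := (abs_le.1 h3).2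
  rw [inner_neg_left]
  linarith

/-- A maximizer over a convex set of a function with the same derivative as a concave function is
a maximizer of the concave function. -/
theorem concave_le_of_isMax {F : Type*} [NormedAddCommGroup F] [NormedSpace ℝ F]
    {Y : Set F} (hY : Convex ℝ Y) {N φ : F → ℝ} (hN : ConcaveOn ℝ Set.univ N) {y₀ : F}
    (hy₀ : y₀ ∈ Y) (hmax : ∀ᶠ y in 𝓝[Y] y₀, φ y ≤ φ y₀)
    (hd : HasFDerivAt (fun y => N y - φ y) (0 : F →L[ℝ] ℝ) y₀) :
    ∀ y ∈ Y, N y ≤ N y₀ := by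
  intro y hy
  by_contra! hcon
  set c : ℝ → F := fun t => y₀ + t • (y - y₀) with hc
  have hcd : HasDerivAt c (y - y₀) 0 := by
    have := ((hasDerivAt_id (0 : ℝ)).smul_const (y - y₀)).const_add y₀
    rw [one_smul] at this
    exact this
  have hc0 : c 0 = y₀ := by simp [hc]
  have hd' : HasDerivAt (fun t => N (c t) - φ (c t)) 0 0 := by
    have := HasFDerivAt.comp_hasDerivAt (f := c) (0 : ℝ) (by rw [hc0]; exact hd) hcd
    rw [zero_apply] at this
    exact this
  have hlit := hd'.isLittleO.def (c := (N y - N y₀) / 2) (by linarith)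
  have hcY : ∀ t : ℝ, 0 < t → t < 1 → c t ∈ Y := fun t h0 h1 =>
    hY.add_smul_sub_mem hy₀ hy ⟨h0.le, h1.le⟩
  have htend : Tendsto c (𝓝[>] 0) (𝓝[Y] y₀) := by
    refine tendsto_nhdsWithin_iff.2 ⟨?_, ?_⟩
    · have := hcd.continuousAt.tendsto
      rw [hc0] at this
      exact this.mono_left nhdsWithin_le_nhds
    · filter_upwards [Ioo_mem_nhdsGT (zero_lt_one' ℝ)] with t ht using hcY t ht.1 ht.2
  have hev := ((htend.eventually hmax).and (Ioo_mem_nhdsGT (zero_lt_one' ℝ))).and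
    (hlit.filter_mono (nhdsWithin_le_nhds (s := Set.Ioi 0)))
  obtain ⟨t, ⟨h1, h2⟩, h3⟩ := hev.exists
  simp only [hc0, sub_zero, smul_eq_mul, mul_zero, Real.norm_eq_abs, abs_of_pos h2.1] at h3
  have h4 := (abs_le.1 h3).2
  have h5 : (1 - t) * N y₀ + t * N y ≤ N (c t) := by
    have := hN.2 (Set.mem_univ y₀) (Set.mem_univ y)
      (show (0 : ℝ) ≤ 1 - t by linarith [h2.2]) h2.1.le (by ring)
    have he : (1 - t) • y₀ + t • y = c t := by simp only [hc]; module
    simpa [he] using this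
  nlinarith [h2.1]

theorem concave_le_of_hasFDerivAt_zero {F : Type*} [NormedAddCommGroup F] [NormedSpace ℝ F]
    {N : F → ℝ} (hN : ConcaveOn ℝ Set.univ N) {y₀ : F}
    (hd : HasFDerivAt N (0 : F →L[ℝ] ℝ) y₀) (y : F) : N y ≤ N y₀ :=
  concave_le_of_isMax (φ := fun _ => 0) convex_univ hN (Set.mem_univ _) (by simp)
    (by simpa using hd) y (Set.mem_univ _)

theorem hasDerivAt_sq_posPart (s : ℝ) :
    HasDerivAt (fun s : ℝ => (max s 0) ^ 2) (2 * max s 0) s := by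
  rw [hasDerivAt_iff_isLittleO]
  have hO : (fun x' : ℝ => (max x' 0) ^ 2 - (max s 0) ^ 2 - (x' - s) • (2 * max s 0))
      =O[𝓝 s] fun x' => (x' - s) ^ 2 := by
    refine Asymptotics.IsBigO.of_bound 1 (Eventually.of_forall fun x => ?_)
    rw [one_mul, Real.norm_eq_abs, Real.norm_eq_abs, abs_of_nonneg (sq_nonneg (x - s)), smul_eq_mul,
      abs_le]
    rcases le_total x 0 with hx | hx <;> rcases le_total s 0 with hs | hs <;>
      simp only [max_eq_left, max_eq_right, hx, hs] <;> constructor <;> nlinarith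
  refine hO.trans_isLittleO ?_
  have h1 : Tendsto (fun x : ℝ => x - s) (𝓝 s) (𝓝 0) := by
    have : Continuous fun x : ℝ => x - s := by fun_prop
    simpa using this.tendsto s
  have := (Asymptotics.isLittleO_pow_id (𝕜 := ℝ) one_lt_two).comp_tendsto h1
  simpa [Function.comp_def] using this

theorem hasStrictDerivAt_sq_posPart (s : ℝ) :
    HasStrictDerivAt (fun s : ℝ => (max s 0) ^ 2) (2 * max s 0) s :=
  hasStrictDerivAt_of_hasDerivAt_of_continuousAt (f' := fun s => 2 * max s 0)
    (Eventually.of_forall hasDerivAt_sq_posPart) (by fun_prop)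

/-! ### Partial gradients -/

section Gradients

variable {n m q : ℕ} {f : EuclideanSpace ℝ (Fin n) → EuclideanSpace ℝ (Fin m) → ℝ}
  {g : EuclideanSpace ℝ (Fin n) → EuclideanSpace ℝ (Fin m) → Fin q → ℝ}

theorem inner_gradient {E : Type*} [NormedAddCommGroup E] [InnerProductSpace ℝ E] [CompleteSpace E]
    (h : E → ℝ) (x d : E) : ⟪gradient h x, d⟫ = fderiv ℝ h x d := by
  rw [← toDual_gradient, InnerProductSpace.toDual_apply_apply]

theorem gradx_eq {x : EuclideanSpace ℝ (Fin n)} {y : EuclideanSpace ℝ (Fin m)}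
    (h : DifferentiableAt ℝ
      (fun p : EuclideanSpace ℝ (Fin n) × EuclideanSpace ℝ (Fin m) => f p.1 p.2) (x, y)) :
    gradx f x y = (InnerProductSpace.toDual ℝ (EuclideanSpace ℝ (Fin n))).symm
      ((fderiv ℝ (fun p : EuclideanSpace ℝ (Fin n) × EuclideanSpace ℝ (Fin m) => f p.1 p.2)
        (x, y)).comp (ContinuousLinearMap.inl ℝ _ _)) := by
  rw [gradx, gradient]
  congr 1
  exact (HasFDerivAt.comp (f := fun x' => (x', y)) x h.hasFDerivAt
    (hasFDerivAt_prodMk_left x y)).fderiv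

theorem grady_eq {x : EuclideanSpace ℝ (Fin n)} {y : EuclideanSpace ℝ (Fin m)}
    (h : DifferentiableAt ℝ
      (fun p : EuclideanSpace ℝ (Fin n) × EuclideanSpace ℝ (Fin m) => f p.1 p.2) (x, y)) :
    grady f x y = (InnerProductSpace.toDual ℝ (EuclideanSpace ℝ (Fin m))).symm
      ((fderiv ℝ (fun p : EuclideanSpace ℝ (Fin n) × EuclideanSpace ℝ (Fin m) => f p.1 p.2)
        (x, y)).comp (ContinuousLinearMap.inr ℝ _ _)) := by
  rw [grady, gradient]
  congr 1
  exact (h.hasFDerivAt.comp y (hasFDerivAt_prodMk_right x y)).fderiv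

theorem inner_gradx {x d : EuclideanSpace ℝ (Fin n)} {y : EuclideanSpace ℝ (Fin m)}
    (h : DifferentiableAt ℝ
      (fun p : EuclideanSpace ℝ (Fin n) × EuclideanSpace ℝ (Fin m) => f p.1 p.2) (x, y)) :
    ⟪gradx f x y, d⟫ =
      fderiv ℝ (fun p : EuclideanSpace ℝ (Fin n) × EuclideanSpace ℝ (Fin m) => f p.1 p.2)
        (x, y) (d, 0) := by
  rw [gradx_eq h, InnerProductSpace.toDual_symm_apply]
  simp

theorem contDiff_gradx
    (h : ContDiff ℝ 2
      (fun p : EuclideanSpace ℝ (Fin n) × EuclideanSpace ℝ (Fin m) => f p.1 p.2)) :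
    ContDiff ℝ 1
      (fun p : EuclideanSpace ℝ (Fin n) × EuclideanSpace ℝ (Fin m) => gradx f p.1 p.2) := by
  have h1 : ContDiff ℝ 1 (fderiv ℝ
      (fun p : EuclideanSpace ℝ (Fin n) × EuclideanSpace ℝ (Fin m) => f p.1 p.2)) :=
    h.fderiv_right (by norm_num)
  have h2 : (fun p : EuclideanSpace ℝ (Fin n) × EuclideanSpace ℝ (Fin m) => gradx f p.1 p.2) =
      fun p => (InnerProductSpace.toDual ℝ (EuclideanSpace ℝ (Fin n))).symm
        ((fderiv ℝ (fun p : EuclideanSpace ℝ (Fin n) × EuclideanSpace ℝ (Fin m) => f p.1 p.2)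
          p).comp (ContinuousLinearMap.inl ℝ _ _)) := by
    funext p
    exact gradx_eq (h.differentiable (by norm_num) _)
  rw [h2]
  exact (InnerProductSpace.toDual ℝ (EuclideanSpace ℝ (Fin n))).symm.contDiff.comp
    (h1.clm_comp contDiff_const)

theorem contDiff_grady
    (h : ContDiff ℝ 2
      (fun p : EuclideanSpace ℝ (Fin n) × EuclideanSpace ℝ (Fin m) => f p.1 p.2)) :
    ContDiff ℝ 1
      (fun p : EuclideanSpace ℝ (Fin n) × EuclideanSpace ℝ (Fin m) => grady f p.1 p.2) := by
  have h1 : ContDiff ℝ 1 (fderiv ℝ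
      (fun p : EuclideanSpace ℝ (Fin n) × EuclideanSpace ℝ (Fin m) => f p.1 p.2)) :=
    h.fderiv_right (by norm_num)
  have h2 : (fun p : EuclideanSpace ℝ (Fin n) × EuclideanSpace ℝ (Fin m) => grady f p.1 p.2) =
      fun p => (InnerProductSpace.toDual ℝ (EuclideanSpace ℝ (Fin m))).symm
        ((fderiv ℝ (fun p : EuclideanSpace ℝ (Fin n) × EuclideanSpace ℝ (Fin m) => f p.1 p.2)
          p).comp (ContinuousLinearMap.inr ℝ _ _)) := by
    funext p
    exact grady_eq (h.differentiable (by norm_num) _)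
  rw [h2]
  exact (InnerProductSpace.toDual ℝ (EuclideanSpace ℝ (Fin m))).symm.contDiff.comp
    (h1.clm_comp contDiff_const)

theorem contDiff_partial_left
    (h : ContDiff ℝ 2
      (fun p : EuclideanSpace ℝ (Fin n) × EuclideanSpace ℝ (Fin m) => f p.1 p.2))
    (y : EuclideanSpace ℝ (Fin m)) : ContDiff ℝ 2 (fun x => f x y) :=
  h.comp (contDiff_id.prodMk contDiff_const)

theorem contDiff_partial_right
    (h : ContDiff ℝ 2
      (fun p : EuclideanSpace ℝ (Fin n) × EuclideanSpace ℝ (Fin m) => f p.1 p.2))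
    (x : EuclideanSpace ℝ (Fin n)) : ContDiff ℝ 2 (f x) :=
  h.comp (contDiff_const.prodMk contDiff_id)

theorem gradient_sub_sum {E : Type*} [NormedAddCommGroup E] [InnerProductSpace ℝ E]
    [CompleteSpace E] {a : E → ℝ} {b : Fin q → E → ℝ} {x : E} (ha : DifferentiableAt ℝ a x)
    (hb : ∀ i, DifferentiableAt ℝ (b i) x) (lam : Fin q → ℝ) :
    gradient (fun x' => a x' - ∑ i, lam i * b i x') x =
      gradient a x - ∑ i, lam i • gradient (b i) x := by
  have h1 : HasFDerivAt (fun x' => a x' - ∑ i, lam i * b i x')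
      (fderiv ℝ a x - ∑ i, lam i • fderiv ℝ (b i) x) x :=
    ha.hasFDerivAt.sub (HasFDerivAt.fun_sum fun i _ => (hb i).hasFDerivAt.const_mul (lam i))
  simp only [gradient, h1.fderiv, map_sub, map_sum, map_smul]

theorem gradyL_eq
    (hf : ContDiff ℝ 2 (fun p : EuclideanSpace ℝ (Fin n) × EuclideanSpace ℝ (Fin m) => f p.1 p.2))
    (hg : ∀ i, ContDiff ℝ 2
      (fun p : EuclideanSpace ℝ (Fin n) × EuclideanSpace ℝ (Fin m) => g p.1 p.2 i))
    (x : EuclideanSpace ℝ (Fin n)) (y : EuclideanSpace ℝ (Fin m)) (lam : Fin q → ℝ) :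
    gradyL f g x y lam = grady f x y - ∑ i, lam i • grady (fun x y => g x y i) x y :=
  gradient_sub_sum ((contDiff_partial_right hf x).differentiable (by norm_num) y)
    (fun i => (contDiff_partial_right (f := fun x y => g x y i) (hg i) x).differentiable
      (by norm_num) y) lam

theorem gradxL_eq
    (hf : ContDiff ℝ 2 (fun p : EuclideanSpace ℝ (Fin n) × EuclideanSpace ℝ (Fin m) => f p.1 p.2))
    (hg : ∀ i, ContDiff ℝ 2
      (fun p : EuclideanSpace ℝ (Fin n) × EuclideanSpace ℝ (Fin m) => g p.1 p.2 i))
    (x : EuclideanSpace ℝ (Fin n)) (y : EuclideanSpace ℝ (Fin m)) (lam : Fin q → ℝ) :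
    gradxL f g x y lam = gradx f x y - ∑ i, lam i • gradx (fun x y => g x y i) x y :=
  gradient_sub_sum ((contDiff_partial_left hf y).differentiable (by norm_num) x)
    (fun i => (contDiff_partial_left (f := fun x y => g x y i) (hg i) y).differentiable
      (by norm_num) x) lam

theorem contDiff_gradyL
    (hf : ContDiff ℝ 2 (fun p : EuclideanSpace ℝ (Fin n) × EuclideanSpace ℝ (Fin m) => f p.1 p.2))
    (hg : ∀ i, ContDiff ℝ 2
      (fun p : EuclideanSpace ℝ (Fin n) × EuclideanSpace ℝ (Fin m) => g p.1 p.2 i)) :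
    ContDiff ℝ 1 (fun w : EuclideanSpace ℝ (Fin n) × EuclideanSpace ℝ (Fin m) × (Fin q → ℝ) =>
      gradyL f g w.1 w.2.1 w.2.2) := by
  simp only [gradyL_eq hf hg]
  have hp : ContDiff ℝ 1
      (fun w : EuclideanSpace ℝ (Fin n) × EuclideanSpace ℝ (Fin m) × (Fin q → ℝ) =>
        (w.1, w.2.1)) := by fun_prop
  refine ((contDiff_grady hf).comp hp).sub (ContDiff.sum fun i _ => ContDiff.fun_smul ?_ ?_)
  · fun_prop
  · exact (contDiff_grady (f := fun x y => g x y i) (hg i)).comp hp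

theorem contDiff_Lag
    (hf : ContDiff ℝ 2 (fun p : EuclideanSpace ℝ (Fin n) × EuclideanSpace ℝ (Fin m) => f p.1 p.2))
    (hg : ∀ i, ContDiff ℝ 2
      (fun p : EuclideanSpace ℝ (Fin n) × EuclideanSpace ℝ (Fin m) => g p.1 p.2 i)) :
    ContDiff ℝ 2 (fun w : EuclideanSpace ℝ (Fin n) × EuclideanSpace ℝ (Fin m) × (Fin q → ℝ) =>
      Lag f g w.1 w.2.1 w.2.2) := by
  have hp : ContDiff ℝ 2
      (fun w : EuclideanSpace ℝ (Fin n) × EuclideanSpace ℝ (Fin m) × (Fin q → ℝ) =>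
        (w.1, w.2.1)) := by fun_prop
  refine (hf.comp hp).sub (ContDiff.sum fun i _ => ContDiff.mul ?_ ?_)
  · fun_prop
  · exact (hg i).comp hp

theorem concaveOn_Lag {x : EuclideanSpace ℝ (Fin n)} (hfx : ConcaveOn ℝ Set.univ (f x))
    (hgx : ∀ i, ConvexOn ℝ Set.univ (fun y => g x y i)) {t : ℝ} (ht : 0 ≤ t) {lam : Fin q → ℝ}
    (hlam : ∀ i, 0 ≤ lam i) :
    ConcaveOn ℝ Set.univ (fun y => t * f x y - ∑ i, lam i * g x y i) := by
  refine ⟨convex_univ, fun y hy z hz a b ha hb hab => ?_⟩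
  have h1 := hfx.2 hy hz ha hb hab
  have h2 : ∑ i, lam i * g x (a • y + b • z) i ≤
      a * ∑ i, lam i * g x y i + b * ∑ i, lam i * g x z i := by
    rw [Finset.mul_sum, Finset.mul_sum, ← Finset.sum_add_distrib]
    refine Finset.sum_le_sum fun i _ => ?_
    have := mul_le_mul_of_nonneg_left ((hgx i).2 hy hz ha hb hab) (hlam i)
    simp only [smul_eq_mul] at this
    linarith
  simp only [smul_eq_mul] at h1 ⊢
  have h3 := mul_le_mul_of_nonneg_left h1 ht
  linarith

/-- The gradient of `y ↦ t f(x, y) - λᵀ g(x, y)`. -/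
theorem hasFDerivAt_scaled_Lag
    (hf : ContDiff ℝ 2 (fun p : EuclideanSpace ℝ (Fin n) × EuclideanSpace ℝ (Fin m) => f p.1 p.2))
    (hg : ∀ i, ContDiff ℝ 2
      (fun p : EuclideanSpace ℝ (Fin n) × EuclideanSpace ℝ (Fin m) => g p.1 p.2 i))
    (x : EuclideanSpace ℝ (Fin n)) (y : EuclideanSpace ℝ (Fin m)) (t : ℝ) (lam : Fin q → ℝ) :
    HasFDerivAt (fun y => t * f x y - ∑ i, lam i * g x y i)
      (InnerProductSpace.toDual ℝ _
        (t • grady f x y - ∑ i, lam i • grady (fun x y => g x y i) x y)) y := by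
  have h1 := (contDiff_partial_right hf x).differentiable (by norm_num) y
  have h2 : ∀ i, DifferentiableAt ℝ (fun y => g x y i) y := fun i =>
    (contDiff_partial_right (f := fun x y => g x y i) (hg i) x).differentiable (by norm_num) y
  have h3 := (h1.hasFDerivAt.const_mul t).sub
    (HasFDerivAt.fun_sum (u := Finset.univ) fun i _ => (h2 i).hasFDerivAt.const_mul (lam i))
  have h4 : InnerProductSpace.toDual ℝ _
      (t • grady f x y - ∑ i, lam i • grady (fun x y => g x y i) x y) =
      t • fderiv ℝ (f x) y - ∑ i, lam i • fderiv ℝ (fun y => g x y i) y := by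
    simp only [map_sub, map_sum, map_smul, grady, toDual_gradient]
  rw [h4]
  exact h3

end Gradients

/-! ### The Wolfe dual system under a qualification condition -/

section Wolfe

variable {n m q : ℕ} {f : EuclideanSpace ℝ (Fin n) → EuclideanSpace ℝ (Fin m) → ℝ}
  {g : EuclideanSpace ℝ (Fin n) → EuclideanSpace ℝ (Fin m) → Fin q → ℝ}

theorem multSetW_smul {W : Type} [NormedAddCommGroup W] [NormedSpace ℝ W] {p p' : ℕ}
    {G : W → Fin p → ℝ} {H : W → Fin p' → ℝ} {β : W →L[ℝ] ℝ} {w : W}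
    {lm : (Fin p → ℝ) × (Fin p' → ℝ)} (h : lm ∈ MultSetW G H β w) {t : ℝ} (ht : 0 ≤ t) :
    t • lm ∈ MultSetW G H (t • β) w := by
  obtain ⟨h1, h2, h3⟩ := h
  refine ⟨fun i => mul_nonneg ht (h1 i), ?_, ?_⟩
  · have : t • β - ∑ i, (t • lm).1 i • fderiv ℝ (fun w => G w i) w -
        ∑ j, (t • lm).2 j • fderiv ℝ (fun w => H w j) w =
        t • (β - ∑ i, lm.1 i • fderiv ℝ (fun w => G w i) w -
        ∑ j, lm.2 j • fderiv ℝ (fun w => H w j) w) := by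
      simp only [Prod.smul_fst, Prod.smul_snd, Pi.smul_apply, smul_eq_mul, smul_sub,
        Finset.smul_sum, smul_smul]
    rw [this, h2, smul_zero]
  · have : ∑ i, (t • lm).1 i * G w i = t * ∑ i, lm.1 i * G w i := by
      simp only [Prod.smul_fst, Pi.smul_apply, smul_eq_mul, Finset.mul_sum, mul_assoc]
    rw [this, h3, mul_zero]

/-- Multipliers of the Wolfe dual system, written out in the three blocks of variables. -/
theorem wolfe_multiplier
    (hf : ContDiff ℝ 2 (fun p : EuclideanSpace ℝ (Fin n) × EuclideanSpace ℝ (Fin m) => f p.1 p.2))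
    (hg : ∀ i, ContDiff ℝ 2
      (fun p : EuclideanSpace ℝ (Fin n) × EuclideanSpace ℝ (Fin m) => g p.1 p.2 i))
    {x a : EuclideanSpace ℝ (Fin n)} {y : EuclideanSpace ℝ (Fin m)} {lam c : Fin q → ℝ}
    {β : EuclideanSpace ℝ (Fin n) × EuclideanSpace ℝ (Fin m) × (Fin q → ℝ) →L[ℝ] ℝ}
    (hβx : ∀ d, β (d, 0, 0) = ⟪a, d⟫) (hβy : ∀ d, β (0, d, 0) = 0)
    (hβl : ∀ i, β (0, 0, Pi.single i 1) = c i)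
    {lm : (Fin q → ℝ) × (Fin m → ℝ)}
    (h : lm ∈ MultSetW (WolfeG n m q) (WolfeH f g) β (x, y, lam)) :
    hessxyLu f g x y lam (WithLp.toLp 2 lm.2) = a ∧
    hessyyLu f g x y lam (WithLp.toLp 2 lm.2) = 0 ∧
    (∀ i, 0 ≤ -(gyTu g x y (WithLp.toLp 2 lm.2) i) - c i) ∧
    ∑ i, lam i * (-(gyTu g x y (WithLp.toLp 2 lm.2) i) - c i) = 0 := by
  obtain ⟨h1, h2, h3⟩ := h
  set u : EuclideanSpace ℝ (Fin m) := WithLp.toLp 2 lm.2 with hu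
  set Φ : EuclideanSpace ℝ (Fin n) × EuclideanSpace ℝ (Fin m) × (Fin q → ℝ) → ℝ :=
    fun w => ⟪gradyL f g w.1 w.2.1 w.2.2, u⟫ with hΦ
  have hL := contDiff_gradyL hf hg
  have hΦd : Differentiable ℝ Φ :=
    (hL.inner ℝ contDiff_const).differentiable (by norm_num)
  have hHd : ∀ j, DifferentiableAt ℝ (fun w => WolfeH f g w j) (x, y, lam) := fun j => by
    have := (EuclideanSpace.proj (𝕜 := ℝ) j).differentiable.comp
      (hL.differentiable (by norm_num))
    exact this _
  have hH : ∑ j, lm.2 j • fderiv ℝ (fun w => WolfeH f g w j) (x, y, lam) =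
      fderiv ℝ Φ (x, y, lam) := by
    have e1 : Φ = fun w => ∑ j, lm.2 j * WolfeH f g w j := by
      funext w
      simp only [hΦ, hu, PiLp.inner_apply, WolfeH]
      rfl
    rw [e1]
    exact (HasFDerivAt.fun_sum fun j _ => (hHd j).hasFDerivAt.const_mul (lm.2 j)).fderiv.symm
  have hG : ∀ i, fderiv ℝ (fun w => WolfeG n m q w i) (x, y, lam) =
      -((ContinuousLinearMap.proj (R := ℝ) (φ := fun _ : Fin q => ℝ) i).comp
        ((ContinuousLinearMap.snd ℝ (EuclideanSpace ℝ (Fin m)) (Fin q → ℝ)).comp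
        (ContinuousLinearMap.snd ℝ (EuclideanSpace ℝ (Fin n)) _))) := fun i =>
    (ContinuousLinearMap.hasFDerivAt
      (-((ContinuousLinearMap.proj (R := ℝ) (φ := fun _ : Fin q => ℝ) i).comp
        ((ContinuousLinearMap.snd ℝ (EuclideanSpace ℝ (Fin m)) (Fin q → ℝ)).comp
        (ContinuousLinearMap.snd ℝ (EuclideanSpace ℝ (Fin n)) _))))).fderiv
  rw [hH] at h2
  simp only [hG] at h2
  have key : ∀ d : EuclideanSpace ℝ (Fin n) × EuclideanSpace ℝ (Fin m) × (Fin q → ℝ),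
      β d + ∑ i, lm.1 i * d.2.2 i = fderiv ℝ Φ (x, y, lam) d := by
    intro d
    have := DFunLike.congr_fun h2 d
    simp at this
    linarith
  have hx : ∀ d, fderiv ℝ Φ (x, y, lam) (d, 0, 0) = ⟪hessxyLu f g x y lam u, d⟫ := by
    intro d
    rw [hessxyLu, inner_gradient]
    have := HasFDerivAt.comp (f := fun x' => (x', y, lam)) x (hΦd (x, y, lam)).hasFDerivAt
      (hasFDerivAt_prodMk_left x (y, lam))
    have h' : fderiv ℝ (fun x' => ⟪gradyL f g x' y lam, u⟫) x = _ := this.fderiv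
    rw [h']
    rfl
  have hy : ∀ d, fderiv ℝ Φ (x, y, lam) (0, d, 0) = ⟪hessyyLu f g x y lam u, d⟫ := by
    intro d
    rw [hessyyLu, inner_gradient]
    have := HasFDerivAt.comp (f := fun y' => (x, y', lam)) y (hΦd (x, y, lam)).hasFDerivAt
      ((hasFDerivAt_prodMk_right x (y, lam)).comp (f := fun y' => (y', lam)) y
        (hasFDerivAt_prodMk_left y lam))
    have h' : fderiv ℝ (fun y' => ⟪gradyL f g x y' lam, u⟫) y = _ := this.fderiv
    rw [h']
    simp
  have hl : ∀ i, fderiv ℝ Φ (x, y, lam) (0, 0, Pi.single i 1) = -(gyTu g x y u i) := by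
    intro i
    have h4 := HasFDerivAt.comp (f := fun l => (x, y, l)) lam (hΦd (x, y, lam)).hasFDerivAt
      ((hasFDerivAt_prodMk_right x (y, lam)).comp (f := fun l => (y, l)) lam
        (hasFDerivAt_prodMk_right y lam))
    have h5 : (Φ ∘ fun l => (x, y, l)) = fun l =>
        ⟪grady f x y, u⟫ - ∑ i, l i * gyTu g x y u i := by
      funext l
      simp only [hΦ, Function.comp, gradyL_eq hf hg, inner_sub_left, sum_inner,
        real_inner_smul_left, gyTu]
    have h6 : HasFDerivAt (fun l : Fin q → ℝ => ⟪grady f x y, u⟫ - ∑ i, l i * gyTu g x y u i)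
        (-∑ i, gyTu g x y u i • (ContinuousLinearMap.proj (R := ℝ) (φ := fun _ : Fin q => ℝ) i))
        lam :=
      (HasFDerivAt.fun_sum fun i _ =>
        (ContinuousLinearMap.hasFDerivAt (ContinuousLinearMap.proj (R := ℝ)
          (φ := fun _ : Fin q => ℝ) i)).mul_const (gyTu g x y u i)).const_sub _
    rw [h5] at h4
    have h7 := DFunLike.congr_fun (h4.unique h6) (Pi.single i 1)
    simp [Pi.single_apply] at h7
    exact h7
  have hlm : ∀ i, -(gyTu g x y u i) - c i = lm.1 i := by
    intro i
    have := key (0, 0, Pi.single i 1)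
    rw [hl, hβl] at this
    simp [Pi.single_apply] at this
    linarith
  refine ⟨?_, ?_, fun i => ?_, ?_⟩
  · refine ext_inner_right ℝ fun d => ?_
    rw [← hx, ← key, hβx]
    simp
  · refine ext_inner_right ℝ fun d => ?_
    rw [← hy, ← key, hβy]
    simp
  · rw [hlm]; exact h1 i
  · simp only [hlm]
    have h8 : ∑ i, lm.1 i * -(lam i) = 0 := h3
    simp only [mul_neg, Finset.sum_neg_distrib, neg_eq_zero] at h8
    rw [← h8]
    exact Finset.sum_congr rfl fun i _ => mul_comm _ _

/-- Partial derivatives of the Lagrangian. -/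
theorem fderiv_Lag
    (hf : ContDiff ℝ 2 (fun p : EuclideanSpace ℝ (Fin n) × EuclideanSpace ℝ (Fin m) => f p.1 p.2))
    (hg : ∀ i, ContDiff ℝ 2
      (fun p : EuclideanSpace ℝ (Fin n) × EuclideanSpace ℝ (Fin m) => g p.1 p.2 i))
    (x : EuclideanSpace ℝ (Fin n)) (y : EuclideanSpace ℝ (Fin m)) (lam : Fin q → ℝ)
    {D : EuclideanSpace ℝ (Fin n) × EuclideanSpace ℝ (Fin m) × (Fin q → ℝ) →L[ℝ] ℝ}
    (hD : D = fderiv ℝ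
      (fun w : EuclideanSpace ℝ (Fin n) × EuclideanSpace ℝ (Fin m) × (Fin q → ℝ) =>
        Lag f g w.1 w.2.1 w.2.2) (x, y, lam)) :
    (∀ d, D (d, 0, 0) = ⟪gradxL f g x y lam, d⟫) ∧
    (∀ d, D (0, d, 0) = ⟪gradyL f g x y lam, d⟫) ∧
    (∀ i, D (0, 0, Pi.single i 1) = -(g x y i)) := by
  set Φ : EuclideanSpace ℝ (Fin n) × EuclideanSpace ℝ (Fin m) × (Fin q → ℝ) → ℝ :=
    fun w => Lag f g w.1 w.2.1 w.2.2 with hΦ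
  have hΦd : Differentiable ℝ Φ := (contDiff_Lag hf hg).differentiable (by norm_num)
  subst hD
  refine ⟨fun d => ?_, fun d => ?_, fun i => ?_⟩
  · rw [gradxL, gradx, inner_gradient]
    have := HasFDerivAt.comp (f := fun x' => (x', y, lam)) x (hΦd (x, y, lam)).hasFDerivAt
      (hasFDerivAt_prodMk_left x (y, lam))
    have h' : fderiv ℝ (fun x' => Lag f g x' y lam) x = _ := this.fderiv
    rw [h']
    rfl
  · rw [gradyL, grady, inner_gradient]
    have := HasFDerivAt.comp (f := fun y' => (x, y', lam)) y (hΦd (x, y, lam)).hasFDerivAt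
      ((hasFDerivAt_prodMk_right x (y, lam)).comp (f := fun y' => (y', lam)) y
        (hasFDerivAt_prodMk_left y lam))
    have h' : fderiv ℝ (fun y' => Lag f g x y' lam) y = _ := this.fderiv
    rw [h']
    simp
  · have h4 := HasFDerivAt.comp (f := fun l => (x, y, l)) lam (hΦd (x, y, lam)).hasFDerivAt
      ((hasFDerivAt_prodMk_right x (y, lam)).comp (f := fun l => (y, l)) lam
        (hasFDerivAt_prodMk_right y lam))
    have h6 : HasFDerivAt (fun l : Fin q → ℝ => f x y - ∑ i, l i * g x y i)
        (-∑ i, g x y i • (ContinuousLinearMap.proj (R := ℝ) (φ := fun _ : Fin q => ℝ) i))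
        lam :=
      (HasFDerivAt.fun_sum fun i _ =>
        (ContinuousLinearMap.hasFDerivAt (ContinuousLinearMap.proj (R := ℝ)
          (φ := fun _ : Fin q => ℝ) i)).mul_const (g x y i)).const_sub _
    have h7 := DFunLike.congr_fun (h4.unique h6) (Pi.single i 1)
    simp [Pi.single_apply] at h7
    exact h7

/-- Weak Wolfe duality. -/
theorem Vfun_le_Lag
    (hf : ContDiff ℝ 2 (fun p : EuclideanSpace ℝ (Fin n) × EuclideanSpace ℝ (Fin m) => f p.1 p.2))
    (hg : ∀ i, ContDiff ℝ 2
      (fun p : EuclideanSpace ℝ (Fin n) × EuclideanSpace ℝ (Fin m) => g p.1 p.2 i))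
    {x : EuclideanSpace ℝ (Fin n)} (hfx : ConcaveOn ℝ Set.univ (f x))
    (hgx : ∀ i, ConvexOn ℝ Set.univ (fun y => g x y i)) {y : EuclideanSpace ℝ (Fin m)}
    {lam : Fin q → ℝ} (hlam : ∀ i, 0 ≤ lam i) (hgr : gradyL f g x y lam = 0) :
    Vfun f g x ≤ (Lag f g x y lam : EReal) := by
  refine sSup_le ?_
  rintro _ ⟨z, hz, rfl⟩
  rw [EReal.coe_le_coe_iff]
  have h1 := hasFDerivAt_scaled_Lag hf hg x y 1 lam
  rw [one_smul, ← gradyL_eq hf hg, hgr, map_zero] at h1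
  have h2 := concave_le_of_hasFDerivAt_zero (concaveOn_Lag hfx hgx zero_le_one hlam) h1 z
  have h3 : ∑ i, lam i * g x z i ≤ 0 :=
    Finset.sum_nonpos fun i _ => mul_nonpos_of_nonneg_of_nonpos (hlam i) (hz i)
  simp only [one_mul] at h2
  rw [Lag]
  linarith

end Wolfe

/-! ### Penalization of the Wolfe dual reformulation -/

/-- A minimizer of `Φ` over `{w ∈ D | w.1 ∈ X}` is a limit of minimizers of penalized problems in
which the constraint `w.1 ∈ X` is decoupled. -/
theorem exists_penalized_minimizers {E F : Type*} [NormedAddCommGroup E] [ProperSpace E]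
    [NormedAddCommGroup F] [ProperSpace F] {X : Set E} (hX : IsClosed X) {D : Set (E × F)}
    (hD : IsClosed D) {Φ Q : E × F → ℝ} (hΦ : Continuous Φ) (hQ : Continuous Q) {wb : E × F}
    (hwX : wb.1 ∈ X) (hwD : wb ∈ D) (hQb : Q wb = 0) (hQpos : ∀ w, 0 ≤ Q w)
    (hQeq : ∀ w, Q w = 0 → w = wb) {r : ℝ} (hr : 0 < r)
    (hmin : ∀ w ∈ D, w.1 ∈ X → w.1 ∈ closedBall wb.1 r → Φ wb ≤ Φ w) :
    ∃ (c : ℕ → ℝ) (x : ℕ → E) (w : ℕ → E × F), (∀ k, 0 ≤ c k) ∧ (∀ k, x k ∈ X) ∧ (∀ k, w k ∈ D) ∧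
      Tendsto x atTop (𝓝 wb.1) ∧ Tendsto w atTop (𝓝 wb) ∧
      (∀ᶠ k in atTop, ∀ᶠ z in 𝓝[X] (x k), c k * ‖(w k).1 - x k‖ ^ 2 ≤ c k * ‖(w k).1 - z‖ ^ 2) ∧
      (∀ᶠ k in atTop, IsLocalMinOn (fun v => Φ v + c k * ‖v.1 - x k‖ ^ 2 + Q v) D (w k)) := by
  set K : Set (E × (E × F)) := (X ∩ closedBall wb.1 r) ×ˢ (D ∩ closedBall wb r) with hK
  have hKc : IsCompact K :=
    ((isCompact_closedBall _ _).inter_left hX).prod ((isCompact_closedBall _ _).inter_left hD)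
  have hbK : (wb.1, wb) ∈ K :=
    ⟨⟨hwX, mem_closedBall_self hr.le⟩, hwD, mem_closedBall_self hr.le⟩
  have hmk : ∀ k : ℕ, ∃ p ∈ K, IsMinOn
      (fun p : E × (E × F) => Φ p.2 + (k : ℝ) * ‖p.2.1 - p.1‖ ^ 2 + Q p.2) K p := fun k =>
    hKc.exists_isMinOn ⟨_, hbK⟩ (by fun_prop)
  choose p hpK hp using hmk
  obtain ⟨pb, hpbK, φ, hφ, hlim⟩ := hKc.tendsto_subseq hpK
  obtain ⟨B, hB⟩ := (hKc.image (hΦ.comp continuous_snd)).bddBelow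
  have hle : ∀ k, Φ (p k).2 + (k : ℝ) * ‖(p k).2.1 - (p k).1‖ ^ 2 + Q (p k).2 ≤ Φ wb := fun k => by
    have := isMinOn_iff.1 (hp k) _ hbK
    simpa [hQb] using this
  have hlim2 : Tendsto (fun k => (p (φ k)).2) atTop (𝓝 pb.2) :=
    (continuous_snd.tendsto pb).comp hlim
  have hlim1 : Tendsto (fun k => (p (φ k)).1) atTop (𝓝 pb.1) :=
    (continuous_fst.tendsto pb).comp hlim
  have hgap : Tendsto (fun k => ‖(p (φ k)).2.1 - (p (φ k)).1‖ ^ 2) atTop (𝓝 0) := by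
    have hz : Tendsto (fun k : ℕ => (Φ wb - B) / (φ k : ℝ)) atTop (𝓝 0) :=
      (tendsto_const_div_atTop_nhds_zero_nat _).comp hφ.tendsto_atTop
    refine tendsto_of_tendsto_of_tendsto_of_le_of_le' tendsto_const_nhds hz
      (Eventually.of_forall fun k => sq_nonneg _) ?_
    filter_upwards [eventually_gt_atTop 0] with k hk
    have hk' : (0 : ℝ) < φ k := Nat.cast_pos.2 (hk.trans_le hφ.le_apply)
    rw [le_div_iff₀ hk']
    have h1 := hle (φ k)
    have h2 : B ≤ Φ (p (φ k)).2 := hB ⟨_, hpK (φ k), rfl⟩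
    have h3 := hQpos (p (φ k)).2
    nlinarith
  have heq : pb.2.1 = pb.1 := by
    have h1 : Tendsto (fun k => ‖(p (φ k)).2.1 - (p (φ k)).1‖ ^ 2) atTop
        (𝓝 (‖pb.2.1 - pb.1‖ ^ 2)) :=
      ((((continuous_fst.tendsto _).comp hlim2).sub hlim1).norm).pow 2
    have := tendsto_nhds_unique h1 hgap
    rwa [sq_eq_zero_iff, norm_eq_zero, sub_eq_zero] at this
  have hwb : pb.2 = wb := by
    refine hQeq _ (le_antisymm ?_ (hQpos _))
    have h1 : Φ pb.2 + Q pb.2 ≤ Φ wb := by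
      refine le_of_tendsto (((hΦ.tendsto _).comp hlim2).add ((hQ.tendsto _).comp hlim2))
        (Eventually.of_forall fun k => ?_)
      have := hle (φ k)
      have h2 : 0 ≤ (φ k : ℝ) * ‖(p (φ k)).2.1 - (p (φ k)).1‖ ^ 2 := by positivity
      simp only [Function.comp]
      linarith
    have h2 := hmin pb.2 hpbK.2.1 (heq ▸ hpbK.1.1) (heq ▸ hpbK.1.2)
    linarith
  rw [← heq] at hlim1
  rw [hwb] at hlim1 hlim2
  refine ⟨fun k => φ k, fun k => (p (φ k)).1, fun k => (p (φ k)).2, fun k => Nat.cast_nonneg _,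
    fun k => (hpK _).1.1, fun k => (hpK _).2.1, hlim1, hlim2, ?_, ?_⟩
  · filter_upwards [hlim1.eventually (ball_mem_nhds _ hr)] with k hk
    filter_upwards [mem_nhdsWithin_of_mem_nhds (isOpen_ball.mem_nhds hk), self_mem_nhdsWithin]
      with z hz hzX
    have := isMinOn_iff.1 (hp (φ k)) (z, (p (φ k)).2) ⟨⟨hzX, ball_subset_closedBall hz⟩, (hpK _).2⟩
    simp only at this
    linarith
  · filter_upwards [hlim2.eventually (ball_mem_nhds _ hr)] with k hk
    filter_upwards [mem_nhdsWithin_of_mem_nhds (isOpen_ball.mem_nhds hk), self_mem_nhdsWithin]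
      with v hv hvD
    exact isMinOn_iff.1 (hp (φ k)) ((p (φ k)).1, v) ⟨(hpK _).1, hvD, ball_subset_closedBall hv⟩

theorem limNC_smul {n : ℕ} {C : Set (EuclideanSpace ℝ (Fin n))}
    {x₀ ξ : EuclideanSpace ℝ (Fin n)} (h : ξ ∈ limNC C x₀) {c : ℝ} (hc : 0 < c) :
    c • ξ ∈ limNC C x₀ := by
  obtain ⟨xk, ξk, h1, h2, h3, h4⟩ := h
  exact ⟨xk, fun k => c • ξk k, h1, fun k => regNC_smul (h2 k) hc, h3, h4.const_smul c⟩

theorem smul_sub_mem_regNC {n : ℕ} {C : Set (EuclideanSpace ℝ (Fin n))}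
    {x w : EuclideanSpace ℝ (Fin n)} {c : ℝ} (hc : 0 ≤ c)
    (h : ∀ᶠ z in 𝓝[C] x, c * ‖w - x‖ ^ 2 ≤ c * ‖w - z‖ ^ 2) :
    (2 * c) • (w - x) ∈ regNC C x := by
  intro ε hε
  obtain ⟨δ, hδ, H⟩ := Metric.eventually_nhds_iff.1 (eventually_nhdsWithin_iff.1 h)
  refine ⟨min δ (ε / (c + 1)), by positivity, fun z hz hzd => ?_⟩
  have h1 := H (y := z) (by rw [dist_eq_norm]; exact hzd.trans_le (min_le_left _ _)) hz
  have h2 : ‖z - x‖ * (c + 1) ≤ ε :=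
    (le_div_iff₀ (by positivity)).1 (hzd.le.trans (min_le_right _ _))
  have h3 : ‖w - z‖ ^ 2 = ‖w - x‖ ^ 2 - 2 * ⟪w - x, z - x⟫ + ‖z - x‖ ^ 2 := by
    rw [← norm_sub_sq_real]
    congr 2
    abel
  rw [h3] at h1
  rw [real_inner_smul_left]
  nlinarith [norm_nonneg (z - x)]

/-- Under a stable constraint qualification on `D = {G ≤ 0, H = 0}`, a minimizer of `Φ` over
`{w ∈ D | w.1 ∈ X}` admits Fritz John type multipliers. -/
theorem StableCQ.exists_fritzJohn {n p p' : ℕ} {F : Type} [NormedAddCommGroup F] [NormedSpace ℝ F]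
    [ProperSpace F] {X : Set (EuclideanSpace ℝ (Fin n))} (hX : IsClosed X)
    {G : EuclideanSpace ℝ (Fin n) × F → Fin p → ℝ} {H : EuclideanSpace ℝ (Fin n) × F → Fin p' → ℝ}
    (hG : ∀ i, Continuous fun w => G w i) (hH : ∀ j, Continuous fun w => H w j)
    {Φ Q : EuclideanSpace ℝ (Fin n) × F → ℝ} (hΦ : ContDiff ℝ 1 Φ) (hQ : ContDiff ℝ 1 Q)
    {wb : EuclideanSpace ℝ (Fin n) × F} (hCQ : StableCQ G H wb)
    (hwX : wb.1 ∈ X) (hwG : ∀ i, G wb i ≤ 0) (hwH : ∀ j, H wb j = 0)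
    (hQb : Q wb = 0) (hQ' : fderiv ℝ Q wb = 0) (hQpos : ∀ w, 0 ≤ Q w)
    (hQeq : ∀ w, Q w = 0 → w = wb) {r : ℝ} (hr : 0 < r)
    (hmin : ∀ w, (∀ i, G w i ≤ 0) → (∀ j, H w j = 0) → w.1 ∈ X → w.1 ∈ closedBall wb.1 r →
      Φ wb ≤ Φ w) :
    ∃ (t : ℝ) (η : EuclideanSpace ℝ (Fin n)), 0 ≤ t ∧ t + ‖η‖ = 1 ∧ -η ∈ limNC X wb.1 ∧
      (MultSetW G H (-(t • fderiv ℝ Φ wb) +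
        (innerSL ℝ η).comp (ContinuousLinearMap.fst ℝ _ _)) wb).Nonempty := by
  set D : Set (EuclideanSpace ℝ (Fin n) × F) := {w | (∀ i, G w i ≤ 0) ∧ ∀ j, H w j = 0} with hD
  have hDc : IsClosed D := by
    refine IsClosed.inter (s₁ := {w | ∀ i, G w i ≤ 0}) (s₂ := {w | ∀ j, H w j = 0}) ?_ ?_
    · simp only [Set.ofPred_forall]
      exact isClosed_iInter fun i => isClosed_le (hG i) continuous_const
    · simp only [Set.ofPred_forall]
      exact isClosed_iInter fun j => isClosed_eq (hH j) continuous_const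
  obtain ⟨c, x, w, hc, hxX, hwD, hx, hw, hxmin, hwmin⟩ :=
    exists_penalized_minimizers hX hDc hΦ.continuous hQ.continuous hwX ⟨hwG, hwH⟩ hQb hQpos hQeq
      hr (fun v hv => hmin v hv.1 hv.2)
  obtain ⟨P, ⟨-, δ, hδ, hP⟩, hKKT, hstab⟩ := hCQ
  set η : ℕ → EuclideanSpace ℝ (Fin n) := fun k => (2 * c k) • (x k - (w k).1) with hη
  set t : ℕ → ℝ := fun k => (1 + ‖η k‖)⁻¹ with ht
  have htpos : ∀ k, 0 < t k := fun k => by simp only [ht]; positivity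
  have htη : ∀ k, t k + ‖t k • η k‖ = 1 := fun k => by
    rw [norm_smul, Real.norm_of_nonneg (htpos k).le]
    simp only [ht]
    field_simp
  have hreg : ∀ᶠ k in atTop, -(t k • η k) ∈ regNC X (x k) := by
    filter_upwards [hxmin] with k hk
    have := regNC_smul (smul_sub_mem_regNC (hc k) hk) (htpos k)
    convert this using 1
    simp only [hη]
    module
  have hmult : ∀ᶠ k in atTop, (MultSetW G H (-(t k • (fderiv ℝ Φ (w k) + fderiv ℝ Q (w k))) +
      (innerSL ℝ (t k • η k)).comp (ContinuousLinearMap.fst ℝ _ _)) (w k)).Nonempty := by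
    have hnear : ∀ᶠ k in atTop, ‖w k - wb‖ < δ := by
      simpa only [dist_eq_norm] using Metric.tendsto_nhds.1 hw δ hδ
    filter_upwards [hwmin, hnear] with k hk hk'
    have hsq : ContDiff ℝ 1 (fun v : EuclideanSpace ℝ (Fin n) × F => c k * ‖v.1 - x k‖ ^ 2) :=
      contDiff_const.mul ((contDiff_fst.sub contDiff_const).norm_sq ℝ)
    obtain ⟨lam, mu, h1, h2, h3⟩ := hKKT (w k) (hP _ (hwD k).1 (hwD k).2 hk') (hwD k).1 (hwD k).2 _
      ((hΦ.add hsq).add hQ) hk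
    have hder : fderiv ℝ (fun v : EuclideanSpace ℝ (Fin n) × F =>
        Φ v + c k * ‖v.1 - x k‖ ^ 2 + Q v) (w k) = fderiv ℝ Φ (w k) -
          (innerSL ℝ (η k)).comp (ContinuousLinearMap.fst ℝ _ _) + fderiv ℝ Q (w k) := by
      have e1 : HasFDerivAt (fun v : EuclideanSpace ℝ (Fin n) × F => v.1 - x k)
          (ContinuousLinearMap.fst ℝ (EuclideanSpace ℝ (Fin n)) F) (w k) := hasFDerivAt_fst.sub_const _
      have e2 := (((hΦ.differentiable (by norm_num) (w k)).hasFDerivAt.add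
        (e1.norm_sq.const_mul (c k))).add
        (hQ.differentiable (by norm_num) (w k)).hasFDerivAt).fderiv
      refine e2.trans ?_
      ext v <;> simp [hη]
      ring
    have h4 : (lam, mu) ∈ MultSetW G H (-(fderiv ℝ Φ (w k) + fderiv ℝ Q (w k)) +
        (innerSL ℝ (η k)).comp (ContinuousLinearMap.fst ℝ _ _)) (w k) := by
      refine ⟨h1, ?_, h3⟩
      rw [hder] at h2
      rw [← neg_eq_zero, ← h2]
      abel
    have h5 := multSetW_smul h4 (htpos k).le
    have h6 : t k • (-(fderiv ℝ Φ (w k) + fderiv ℝ Q (w k)) +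
        (innerSL ℝ (η k)).comp (ContinuousLinearMap.fst ℝ _ _)) =
        -(t k • (fderiv ℝ Φ (w k) + fderiv ℝ Q (w k))) +
        (innerSL ℝ (t k • η k)).comp (ContinuousLinearMap.fst ℝ _ _) := by
      rw [smul_add, smul_neg, (innerSL ℝ).map_smul (t k) (η k)]
      rfl
    rw [h6] at h5
    exact ⟨_, h5⟩
  obtain ⟨N, hN⟩ := eventually_atTop.1 hmult
  have hbd : ∀ k, (t k, t k • η k) ∈ Set.Icc (0 : ℝ) 1 ×ˢ
      closedBall (0 : EuclideanSpace ℝ (Fin n)) 1 := fun k =>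
    ⟨⟨(htpos k).le, by linarith [htη k, norm_nonneg (t k • η k)]⟩,
      mem_closedBall_zero_iff.2 (by linarith [htη k, htpos k])⟩
  obtain ⟨⟨tb, ηb⟩, hb, φ, hφ, hlim⟩ := (isCompact_Icc.prod
    (isCompact_closedBall (0 : EuclideanSpace ℝ (Fin n)) 1)).tendsto_subseq
      (fun k => hbd (k + N))
  have hψ : Tendsto (fun k => φ k + N) atTop atTop :=
    (tendsto_add_atTop_nat N).comp hφ.tendsto_atTop
  have htl : Tendsto (fun k => t (φ k + N)) atTop (𝓝 tb) :=
    (continuous_fst.tendsto (tb, ηb)).comp hlim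
  have hηl : Tendsto (fun k => t (φ k + N) • η (φ k + N)) atTop (𝓝 ηb) :=
    (continuous_snd.tendsto (tb, ηb)).comp hlim
  have hwl := hw.comp hψ
  refine ⟨tb, ηb, hb.1.1, ?_, ?_, ?_⟩
  · exact tendsto_nhds_unique (htl.add hηl.norm) (by simp only [htη]; exact tendsto_const_nhds)
  · exact limNC_of_eventually (Eventually.of_forall fun k => hxX _) (hψ.eventually hreg)
      (hx.comp hψ) hηl.neg
  · have hβ : Tendsto (fun k => -(t (φ k + N) • (fderiv ℝ Φ (w (φ k + N)) +
        fderiv ℝ Q (w (φ k + N)))) + (innerSL ℝ (t (φ k + N) • η (φ k + N))).comp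
        (ContinuousLinearMap.fst ℝ _ F)) atTop
        (𝓝 (-(tb • fderiv ℝ Φ wb) + (innerSL ℝ ηb).comp (ContinuousLinearMap.fst ℝ _ F))) := by
      have e1 := ((hΦ.continuous_fderiv (by norm_num)).tendsto wb).comp hwl
      have e2 := ((hQ.continuous_fderiv (by norm_num)).tendsto wb).comp hwl
      rw [hQ'] at e2
      have e3 := htl.smul (e1.add e2)
      rw [add_zero] at e3
      have e4 : Continuous fun η : EuclideanSpace ℝ (Fin n) =>
          (innerSL ℝ η).comp (ContinuousLinearMap.fst ℝ (EuclideanSpace ℝ (Fin n)) F) :=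
        (innerSL ℝ).continuous.clm_comp continuous_const
      exact e3.neg.add ((e4.tendsto ηb).comp hηl)
    obtain ⟨-, -, lmb, -, -, -, h⟩ := hstab _ _ _ hβ hwl (fun k => hwD _) (fun k => hN _ (by omega))
    exact ⟨lmb, h⟩

section WolfeCase

variable {n m q : ℕ} {f : EuclideanSpace ℝ (Fin n) → EuclideanSpace ℝ (Fin m) → ℝ}
  {g : EuclideanSpace ℝ (Fin n) → EuclideanSpace ℝ (Fin m) → Fin q → ℝ}

/-- Necessary optimality condition through Wolfe duality, under a stable constraint qualification
for the dual system and a qualification condition excluding singular multipliers. -/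
theorem exists_stationary_of_stableCQ
    {X : Set (EuclideanSpace ℝ (Fin n))} (hXc : IsClosed X)
    (hf : ContDiff ℝ 2 (fun p : EuclideanSpace ℝ (Fin n) × EuclideanSpace ℝ (Fin m) => f p.1 p.2))
    (hg : ∀ i, ContDiff ℝ 2
      (fun p : EuclideanSpace ℝ (Fin n) × EuclideanSpace ℝ (Fin m) => g p.1 p.2 i))
    (hconv : ∀ x ∈ X, ConcaveOn ℝ Set.univ (f x) ∧ ∀ i, ConvexOn ℝ Set.univ (fun y => g x y i))
    {xb : EuclideanSpace ℝ (Fin n)} (hxbX : xb ∈ X) (hmin : IsLocalMinOn (Vfun f g) X xb)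
    {yb : EuclideanSpace ℝ (Fin m)} (hyb : yb ∈ Sol f g xb) {lamb : Fin q → ℝ}
    (hlamb : lamb ∈ SigmaSet f g xb yb)
    (hCQ : StableCQ (WolfeG n m q) (WolfeH f g) (xb, yb, lamb))
    (hqual : ∀ u, hessyyLu f g xb yb lamb u = 0 → (∀ i, 0 ≤ -(gyTu g xb yb u i)) →
      ∑ i, lamb i * gyTu g xb yb u i = 0 → hessxyLu f g xb yb lamb u = 0) :
    ∃ u : EuclideanSpace ℝ (Fin m),
      -(gradxL f g xb yb lamb + hessxyLu f g xb yb lamb u) ∈ limNC X xb ∧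
      hessyyLu f g xb yb lamb u = 0 ∧
      (∀ i, 0 ≤ -(gyTu g xb yb u i) - g xb yb i) ∧
      ∑ i, lamb i * (-(gyTu g xb yb u i) - g xb yb i) = 0 := by
  obtain ⟨hgr, hpos, -, hcomp⟩ := hlamb
  have hL : ContDiff ℝ 1 (fun w : EuclideanSpace ℝ (Fin n) × EuclideanSpace ℝ (Fin m) ×
      (Fin q → ℝ) => Lag f g w.1 w.2.1 w.2.2) := (contDiff_Lag hf hg).of_le (by norm_num)
  set Q : EuclideanSpace ℝ (Fin n) × EuclideanSpace ℝ (Fin m) × (Fin q → ℝ) → ℝ :=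
    fun w => ‖w.1 - xb‖ ^ 2 + ‖w.2.1 - yb‖ ^ 2 + ∑ i, (w.2.2 i - lamb i) ^ 2 with hQ
  have hQd : ContDiff ℝ 1 Q := by
    refine (ContDiff.add (ContDiff.norm_sq ℝ ?_) (ContDiff.norm_sq ℝ ?_)).add
      (ContDiff.sum fun i _ => ?_) <;> fun_prop
  have hQpos : ∀ w, 0 ≤ Q w := fun w => by simp only [hQ]; positivity
  have hQb : Q (xb, yb, lamb) = 0 := by simp [hQ]
  have hQeq : ∀ w, Q w = 0 → w = (xb, yb, lamb) := by
    rintro ⟨x, y, lam⟩ h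
    have h3 : 0 ≤ ∑ i, (lam i - lamb i) ^ 2 := Finset.sum_nonneg fun i _ => sq_nonneg _
    have h1 := sq_nonneg ‖x - xb‖
    have h2 := sq_nonneg ‖y - yb‖
    simp only [hQ] at h
    have e1 : ‖x - xb‖ ^ 2 = 0 := by linarith
    have e2 : ‖y - yb‖ ^ 2 = 0 := by linarith
    have e3 : ∑ i, (lam i - lamb i) ^ 2 = 0 := by linarith
    rw [sq_eq_zero_iff, norm_eq_zero, sub_eq_zero] at e1 e2
    rw [Finset.sum_eq_zero_iff_of_nonneg fun i _ => sq_nonneg _] at e3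
    have e4 : lam = lamb := funext fun i =>
      sub_eq_zero.1 (sq_eq_zero_iff.1 (e3 i (Finset.mem_univ i)))
    rw [e1, e2, e4]
  have hQ' : fderiv ℝ Q (xb, yb, lamb) = 0 :=
    IsLocalMin.fderiv_eq_zero (Eventually.of_forall fun w => by rw [hQb]; exact hQpos w)
  obtain ⟨r, hr, hball⟩ := Metric.eventually_nhds_iff.1 (eventually_nhdsWithin_iff.1 hmin)
  have hminL : ∀ w : EuclideanSpace ℝ (Fin n) × EuclideanSpace ℝ (Fin m) × (Fin q → ℝ),
      (∀ i, WolfeG n m q w i ≤ 0) → (∀ j, WolfeH f g w j = 0) → w.1 ∈ X →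
      w.1 ∈ closedBall xb (r / 2) →
      Lag f g xb yb lamb ≤ Lag f g w.1 w.2.1 w.2.2 := by
    intro w h1 h2 h3 h4
    have h5 : Vfun f g xb ≤ Vfun f g w.1 :=
      hball (y := w.1) ((mem_closedBall.1 h4).trans_lt (half_lt_self hr)) h3
    have h6 := Vfun_le_Lag hf hg (hconv _ h3).1 (hconv _ h3).2 (y := w.2.1) (lam := w.2.2)
      (fun i => neg_nonpos.1 (h1 i)) (by ext j; exact h2 j)
    have h7 := h5.trans h6
    rw [← hyb.2, EReal.coe_le_coe_iff] at h7
    rwa [show Lag f g xb yb lamb = f xb yb by rw [Lag, hcomp, sub_zero]]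
  have hWG : ∀ i, Continuous fun w => WolfeG n m q w i := fun i => by
    unfold WolfeG
    fun_prop
  have hWH : ∀ j, Continuous fun w => WolfeH f g w j := fun j =>
    (EuclideanSpace.proj (𝕜 := ℝ) j).continuous.comp (contDiff_gradyL hf hg).continuous
  obtain ⟨t, η, ht, htη, hη, lm, hlm⟩ := StableCQ.exists_fritzJohn hXc hWG hWH hL hQd hCQ hxbX
    (fun i => neg_nonpos.2 (hpos i)) (fun j => by simp [WolfeH, hgr]) hQb hQ' hQpos hQeq
    (half_pos hr) hminL
  obtain ⟨d1, d2, d3⟩ := fderiv_Lag hf hg xb yb lamb rfl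
  rw [hgr] at d2
  rcases ht.eq_or_lt with rfl | htpos
  · exfalso
    obtain ⟨h1, h2, h3, h4⟩ := wolfe_multiplier hf hg (a := η) (c := 0) (by simp) (by simp)
      (by simp) hlm
    have h5 := hqual _ h2 (by simpa using h3) (by simpa using h4)
    rw [h1] at h5
    simp [h5] at htη
  · have hlm' := multSetW_smul hlm (inv_nonneg.2 htpos.le)
    obtain ⟨h1, h2, h3, h4⟩ := wolfe_multiplier hf hg (a := -gradxL f g xb yb lamb + t⁻¹ • η)
      (c := g xb yb) (fun d => by
        simp [d1, inner_add_left, real_inner_smul_left]; field_simp)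
      (fun d => by simp [d2]) (fun i => by simp [d3]; field_simp) hlm'
    refine ⟨_, ?_, h2, h3, h4⟩
    rw [h1]
    have := limNC_smul hη (inv_pos.2 htpos)
    convert this using 1
    module

end WolfeCase

/-! ### Penalization of the lower level constraints -/

theorem exists_minimax {E F : Type*} [TopologicalSpace E] [TopologicalSpace F]
    {A : Set E} {Y : Set F} (hA : IsCompact A) (hY : IsCompact Y) (hAne : A.Nonempty)
    (hYne : Y.Nonempty) {φ : E × F → ℝ} (hφ : Continuous φ) :
    ∃ x₀ ∈ A, ∃ y₀ ∈ Y, (∀ y ∈ Y, φ (x₀, y) ≤ φ (x₀, y₀)) ∧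
      ∀ x ∈ A, ∃ y ∈ Y, φ (x₀, y₀) ≤ φ (x, y) := by
  have hmax : ∀ x, ∃ y ∈ Y, ∀ z ∈ Y, φ (x, z) ≤ φ (x, y) := fun x => by
    obtain ⟨y, hy, h⟩ := hY.exists_isMaxOn hYne
      (f := fun y => φ (x, y)) (by fun_prop)
    exact ⟨y, hy, isMaxOn_iff.1 h⟩
  have hcont : Continuous fun x => sSup ((fun y => φ (x, y)) '' Y) :=
    hY.continuous_sSup (f := fun x y => φ (x, y)) (by fun_prop)
  obtain ⟨x₀, hx₀, hmin⟩ := hA.exists_isMinOn hAne hcont.continuousOn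
  have hval : ∀ x y, y ∈ Y → (∀ z ∈ Y, φ (x, z) ≤ φ (x, y)) →
      sSup ((fun y => φ (x, y)) '' Y) = φ (x, y) := fun x y hy h =>
    IsGreatest.csSup_eq ⟨⟨y, hy, rfl⟩, by rintro _ ⟨z, hz, rfl⟩; exact h z hz⟩
  obtain ⟨y₀, hy₀, h₀⟩ := hmax x₀
  refine ⟨x₀, hx₀, y₀, hy₀, h₀, fun x hx => ?_⟩
  obtain ⟨y, hy, h⟩ := hmax x
  have := isMinOn_iff.1 hmin x hx
  rw [hval _ _ hy₀ h₀, hval _ _ hy h] at this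
  exact ⟨y, hy, this⟩

section Penalty

variable {n m q : ℕ} {f : EuclideanSpace ℝ (Fin n) → EuclideanSpace ℝ (Fin m) → ℝ}
  {g : EuclideanSpace ℝ (Fin n) → EuclideanSpace ℝ (Fin m) → Fin q → ℝ}

/-- The penalized and regularized objective of the lower level problem. -/
noncomputable def penObj (f : EuclideanSpace ℝ (Fin n) → EuclideanSpace ℝ (Fin m) → ℝ)
    (g : EuclideanSpace ℝ (Fin n) → EuclideanSpace ℝ (Fin m) → Fin q → ℝ)
    (xb : EuclideanSpace ℝ (Fin n)) (yb : EuclideanSpace ℝ (Fin m)) (K ε : ℝ)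
    (p : EuclideanSpace ℝ (Fin n) × EuclideanSpace ℝ (Fin m)) : ℝ :=
  f p.1 p.2 - K / 2 * ∑ i, (max (g p.1 p.2 i) 0) ^ 2 - ε * ‖p.2 - yb‖ ^ 2 + ‖p.1 - xb‖ ^ 2

/-- The multiplier estimate associated with the quadratic penalty. -/
noncomputable def penMult (g : EuclideanSpace ℝ (Fin n) → EuclideanSpace ℝ (Fin m) → Fin q → ℝ) (K : ℝ)
    (x : EuclideanSpace ℝ (Fin n)) (y : EuclideanSpace ℝ (Fin m)) : Fin q → ℝ :=
  fun i => K * max (g x y i) 0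

theorem continuous_penObj
    (hf : ContDiff ℝ 2 (fun p : EuclideanSpace ℝ (Fin n) × EuclideanSpace ℝ (Fin m) => f p.1 p.2))
    (hg : ∀ i, ContDiff ℝ 2
      (fun p : EuclideanSpace ℝ (Fin n) × EuclideanSpace ℝ (Fin m) => g p.1 p.2 i))
    (xb : EuclideanSpace ℝ (Fin n)) (yb : EuclideanSpace ℝ (Fin m)) (K ε : ℝ) :
    Continuous (penObj f g xb yb K ε) := by
  have h1 := hf.continuous
  have h2 := fun i => (hg i).continuous
  unfold penObj
  fun_prop

theorem exists_hasStrictFDerivAt_penObj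
    (hf : ContDiff ℝ 2 (fun p : EuclideanSpace ℝ (Fin n) × EuclideanSpace ℝ (Fin m) => f p.1 p.2))
    (hg : ∀ i, ContDiff ℝ 2
      (fun p : EuclideanSpace ℝ (Fin n) × EuclideanSpace ℝ (Fin m) => g p.1 p.2 i))
    (xb : EuclideanSpace ℝ (Fin n)) (yb : EuclideanSpace ℝ (Fin m)) (K ε : ℝ)
    (x : EuclideanSpace ℝ (Fin n)) (y : EuclideanSpace ℝ (Fin m)) :
    ∃ φ' : EuclideanSpace ℝ (Fin n) × EuclideanSpace ℝ (Fin m) →L[ℝ] ℝ,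
      HasStrictFDerivAt (penObj f g xb yb K ε) φ' (x, y) ∧
      ∀ d, φ' (d, 0) = ⟪gradxL f g x y (penMult g K x y) + (2 : ℝ) • (x - xb), d⟫ := by
  have h1 : HasStrictFDerivAt (fun p : EuclideanSpace ℝ (Fin n) × EuclideanSpace ℝ (Fin m) =>
      f p.1 p.2) _ (x, y) := hf.contDiffAt.hasStrictFDerivAt (by norm_num)
  have h2 : ∀ i, HasStrictFDerivAt (fun p : EuclideanSpace ℝ (Fin n) × EuclideanSpace ℝ (Fin m) =>
      g p.1 p.2 i) _ (x, y) := fun i => (hg i).contDiffAt.hasStrictFDerivAt (by norm_num)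
  have h3 := fun i => (hasStrictDerivAt_sq_posPart (g x y i)).comp_hasStrictFDerivAt (x, y) (h2 i)
  have h4 := (HasStrictFDerivAt.fun_sum (u := Finset.univ) fun i _ => h3 i).const_mul (K / 2)
  have h5 : HasStrictFDerivAt (fun p : EuclideanSpace ℝ (Fin n) × EuclideanSpace ℝ (Fin m) =>
      ‖p.2 - yb‖ ^ 2) _ (x, y) :=
    (hasStrictFDerivAt_norm_sq (y - yb)).comp (x, y) (HasStrictFDerivAt.sub_const yb
      (ContinuousLinearMap.snd ℝ (EuclideanSpace ℝ (Fin n)) _).hasStrictFDerivAt)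
  have h6 : HasStrictFDerivAt (fun p : EuclideanSpace ℝ (Fin n) × EuclideanSpace ℝ (Fin m) =>
      ‖p.1 - xb‖ ^ 2) _ (x, y) :=
    (hasStrictFDerivAt_norm_sq (x - xb)).comp (x, y) (HasStrictFDerivAt.sub_const xb
      (ContinuousLinearMap.fst ℝ _ (EuclideanSpace ℝ (Fin m))).hasStrictFDerivAt)
  refine ⟨_, ((h1.sub h4).sub (h5.const_mul ε)).add h6, fun d => ?_⟩
  have e1 := inner_gradx (f := f) (d := d) (hf.differentiable (by norm_num) (x, y))
  have e2 := fun i => inner_gradx (f := fun x y => g x y i) (d := d)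
    ((hg i).differentiable (by norm_num) (x, y))
  rw [gradxL_eq hf hg, inner_add_left, inner_sub_left, sum_inner, e1]
  simp only [real_inner_smul_left, e2, penMult]
  simp [Finset.mul_sum, inner_sub_left]
  exact Finset.sum_congr rfl fun i _ => by ring

theorem hasFDerivAt_scaled_Lag_sub_penObj
    (hg : ∀ i, ContDiff ℝ 2
      (fun p : EuclideanSpace ℝ (Fin n) × EuclideanSpace ℝ (Fin m) => g p.1 p.2 i))
    (xb : EuclideanSpace ℝ (Fin n)) (yb : EuclideanSpace ℝ (Fin m)) (K ε : ℝ)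
    (x : EuclideanSpace ℝ (Fin n)) (y : EuclideanSpace ℝ (Fin m)) :
    HasFDerivAt (fun z => (1 * f x z - ∑ i, penMult g K x y i * g x z i - ε * ‖z - yb‖ ^ 2) -
      penObj f g xb yb K ε (x, z)) (0 : EuclideanSpace ℝ (Fin m) →L[ℝ] ℝ) y := by
  have h2 : ∀ i, HasFDerivAt (fun z => g x z i) (fderiv ℝ (fun z => g x z i) y) y := fun i =>
    ((contDiff_partial_right (f := fun x y => g x y i) (hg i) x).differentiable
      (by norm_num) y).hasFDerivAt
  have h3 := fun i => (hasDerivAt_sq_posPart (g x y i)).comp_hasFDerivAt y (h2 i)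
  have h4 := (HasFDerivAt.fun_sum (u := Finset.univ) fun i _ => h3 i).const_mul (K / 2)
  have h5 := HasFDerivAt.fun_sum (u := Finset.univ) fun i _ =>
    (h2 i).const_mul (penMult g K x y i)
  have h6 := (h4.sub h5).sub_const (‖x - xb‖ ^ 2)
  have h7 : (K / 2) • ∑ i, (2 * max (g x y i) 0) • fderiv ℝ (fun z => g x z i) y -
      ∑ i, penMult g K x y i • fderiv ℝ (fun z => g x z i) y = 0 := by
    rw [sub_eq_zero, Finset.smul_sum]
    refine Finset.sum_congr rfl fun i _ => ?_
    rw [smul_smul, penMult]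
    congr 1
    ring
  rw [h7] at h6
  refine h6.congr_of_eventuallyEq (Eventually.of_forall fun z => ?_)
  simp only [penObj, Function.comp, Pi.sub_apply]
  ring

theorem penObj_lt_of_isMax {x : EuclideanSpace ℝ (Fin n)} (hfx : ConcaveOn ℝ Set.univ (f x))
    (hgx : ∀ i, ConvexOn ℝ Set.univ (fun y => g x y i)) {xb : EuclideanSpace ℝ (Fin n)}
    {yb : EuclideanSpace ℝ (Fin m)} {K ε : ℝ} (hK : 0 ≤ K) (hε : 0 < ε)
    {Y : Set (EuclideanSpace ℝ (Fin m))} (hY : Convex ℝ Y) {y₀ : EuclideanSpace ℝ (Fin m)}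
    (hy₀ : y₀ ∈ Y)
    (hmax : ∀ y ∈ Y, penObj f g xb yb K ε (x, y) ≤ penObj f g xb yb K ε (x, y₀))
    {y : EuclideanSpace ℝ (Fin m)} (hy : y ∈ Y) (hne : y ≠ y₀) :
    penObj f g xb yb K ε (x, y) < penObj f g xb yb K ε (x, y₀) := by
  have hz : (1 / 2 : ℝ) • y + (1 / 2 : ℝ) • y₀ ∈ Y :=
    hY hy hy₀ (by norm_num) (by norm_num) (by norm_num)
  have h0 := hmax _ hz
  have h1 := hfx.2 (Set.mem_univ y) (Set.mem_univ y₀) (show (0 : ℝ) ≤ 1 / 2 by norm_num)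
    (show (0 : ℝ) ≤ 1 / 2 by norm_num) (by norm_num)
  have h2 : ∑ i, (max (g x ((1 / 2 : ℝ) • y + (1 / 2 : ℝ) • y₀) i) 0) ^ 2 ≤
      1 / 2 * ∑ i, (max (g x y i) 0) ^ 2 + 1 / 2 * ∑ i, (max (g x y₀ i) 0) ^ 2 := by
    rw [Finset.mul_sum, Finset.mul_sum, ← Finset.sum_add_distrib]
    refine Finset.sum_le_sum fun i _ => ?_
    have h3 := (hgx i).2 (Set.mem_univ y) (Set.mem_univ y₀) (show (0 : ℝ) ≤ 1 / 2 by norm_num)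
      (show (0 : ℝ) ≤ 1 / 2 by norm_num) (by norm_num)
    simp only [smul_eq_mul] at h3
    have h4 : max (g x ((1 / 2 : ℝ) • y + (1 / 2 : ℝ) • y₀) i) 0 ≤
        1 / 2 * (max (g x y i) 0 + max (g x y₀ i) 0) := by
      refine max_le ?_ (by positivity)
      linarith [le_max_left (g x y i) 0, le_max_left (g x y₀ i) 0]
    have h5 := pow_le_pow_left₀ (le_max_right _ _) h4 2
    nlinarith [sq_nonneg (max (g x y i) 0 - max (g x y₀ i) 0)]
  have h6 : ‖(1 / 2 : ℝ) • y + (1 / 2 : ℝ) • y₀ - yb‖ ^ 2 =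
      1 / 2 * ‖y - yb‖ ^ 2 + 1 / 2 * ‖y₀ - yb‖ ^ 2 - 1 / 4 * ‖y - y₀‖ ^ 2 := by
    have e1 : (1 / 2 : ℝ) • y + (1 / 2 : ℝ) • y₀ - yb =
        (1 / 2 : ℝ) • ((y - yb) + (y₀ - yb)) := by module
    have e2 : y - y₀ = (y - yb) - (y₀ - yb) := by abel
    have e3 := parallelogram_law_with_norm ℝ (y - yb) (y₀ - yb)
    rw [← e2] at e3
    rw [e1, norm_smul, mul_pow, Real.norm_of_nonneg (by norm_num)]
    linarith
  have h7 : 0 < ‖y - y₀‖ ^ 2 := by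
    have := norm_pos_iff.2 (sub_ne_zero.2 hne)
    positivity
  have h8 := mul_le_mul_of_nonneg_left h2 (show 0 ≤ K / 2 by positivity)
  have h9 := mul_pos hε h7
  simp only [penObj, smul_eq_mul, h6] at h0 h1 ⊢
  linarith

/-- A sequence of solutions of penalized minimax problems converging to a solution. -/
theorem exists_penObj_minimax_seq
    (hf : ContDiff ℝ 2 (fun p : EuclideanSpace ℝ (Fin n) × EuclideanSpace ℝ (Fin m) => f p.1 p.2))
    (hg : ∀ i, ContDiff ℝ 2
      (fun p : EuclideanSpace ℝ (Fin n) × EuclideanSpace ℝ (Fin m) => g p.1 p.2 i))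
    {X : Set (EuclideanSpace ℝ (Fin n))} (hX : IsClosed X) {xb : EuclideanSpace ℝ (Fin n)}
    (hxb : xb ∈ X) {yb : EuclideanSpace ℝ (Fin m)} {r ρ c : ℝ} (hr : 0 < r) (hρ : 0 < ρ)
    (hV : ∀ x ∈ X ∩ closedBall xb r, ∃ y ∈ closedBall yb ρ, y ∈ Feas g x ∧ c ≤ f x y)
    (hub : ∀ y ∈ Feas g xb, f xb y ≤ c) :
    ∃ (K ε : ℕ → ℝ) (x : ℕ → EuclideanSpace ℝ (Fin n)) (y : ℕ → EuclideanSpace ℝ (Fin m))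
      (ys : EuclideanSpace ℝ (Fin m)), (∀ k, 0 ≤ K k) ∧ (∀ k, 0 < ε k) ∧
      Tendsto ε atTop (𝓝 0) ∧ (∀ k, x k ∈ X) ∧ (∀ k, y k ∈ closedBall yb ρ) ∧
      Tendsto x atTop (𝓝 xb) ∧ Tendsto y atTop (𝓝 ys) ∧ ys ∈ closedBall yb ρ ∧
      ys ∈ Feas g xb ∧ f xb ys = c ∧
      (∀ k, ∀ z ∈ closedBall yb ρ,
        penObj f g xb yb (K k) (ε k) (x k, z) ≤ penObj f g xb yb (K k) (ε k) (x k, y k)) ∧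
      ∀ᶠ k in atTop, ∀ᶠ v in 𝓝[X] (x k), ∃ z ∈ closedBall yb ρ,
        penObj f g xb yb (K k) (ε k) (x k, y k) ≤ penObj f g xb yb (K k) (ε k) (v, z) := by
  have hfc := hf.continuous
  have hgc := fun i => (hg i).continuous
  set A := X ∩ closedBall xb r with hA
  set Y := closedBall yb ρ with hY
  have hAc : IsCompact A := (isCompact_closedBall xb r).inter_left hX
  have hYc : IsCompact Y := isCompact_closedBall yb ρ
  have hxA : xb ∈ A := ⟨hxb, mem_closedBall_self hr.le⟩
  have hyY : yb ∈ Y := mem_closedBall_self hρ.le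
  set ε : ℕ → ℝ := fun k => 1 / ((k : ℝ) + 1) with hε
  have hεpos : ∀ k, 0 < ε k := fun k => by simp only [hε]; positivity
  have hε1 : ∀ k, ε k ≤ 1 := fun k => by
    simp only [hε]
    rw [div_le_one (by positivity)]
    linarith [Nat.cast_nonneg (α := ℝ) k]
  have hε0 : Tendsto ε atTop (𝓝 0) := tendsto_one_div_add_atTop_nhds_zero_nat
  have hpc := fun k : ℕ => continuous_penObj hf hg xb yb k (ε k)
  choose x hx y hy hymax hxmin using fun k : ℕ => exists_minimax hAc hYc ⟨xb, hxA⟩ ⟨yb, hyY⟩ (hpc k)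
  have hz : ∀ k : ℕ, ∃ z ∈ Y, penObj f g xb yb k (ε k) (x k, y k) ≤
      penObj f g xb yb k (ε k) (xb, z) := fun k => hxmin k xb hxA
  choose z hzY hz using hz
  have hlow : ∀ k : ℕ, c - ε k * ρ ^ 2 + ‖x k - xb‖ ^ 2 ≤
      penObj f g xb yb k (ε k) (x k, y k) := fun k => by
    obtain ⟨v, hvY, hvF, hv⟩ := hV (x k) (hx k)
    refine le_trans ?_ (hymax k v hvY)
    have h1 : ∑ i, (max (g (x k) v i) 0) ^ 2 = 0 :=
      Finset.sum_eq_zero fun i _ => by rw [max_eq_right (hvF i)]; norm_num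
    have h2 : ‖v - yb‖ ^ 2 ≤ ρ ^ 2 :=
      pow_le_pow_left₀ (norm_nonneg _) (mem_closedBall_iff_norm.1 hvY) 2
    have h3 := mul_le_mul_of_nonneg_left h2 (hεpos k).le
    simp only [penObj, h1]
    linarith
  set S : EuclideanSpace ℝ (Fin n) × EuclideanSpace ℝ (Fin m) → ℝ :=
    fun p => ∑ i, (max (g p.1 p.2 i) 0) ^ 2 with hS
  have hSc : Continuous S := by fun_prop
  have hSpos : ∀ p, 0 ≤ S p := fun p => Finset.sum_nonneg fun i _ => sq_nonneg _
  have hfeas : ∀ a b, S (a, b) = 0 → b ∈ Feas g a := fun a b h i => by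
    have := (Finset.sum_eq_zero_iff_of_nonneg fun i _ => sq_nonneg _).1 h i (Finset.mem_univ i)
    rw [sq_eq_zero_iff] at this
    exact this ▸ le_max_left _ _
  obtain ⟨B, hB⟩ := ((hAc.prod hYc).image
    (f := fun p => f p.1 p.2 + ‖p.1 - xb‖ ^ 2) (by fun_prop)).bddAbove
  have hB' : ∀ a ∈ A, ∀ b ∈ Y, f a b + ‖a - xb‖ ^ 2 ≤ B := fun a ha b hb =>
    hB ⟨(a, b), ⟨ha, hb⟩, rfl⟩
  have hpen : ∀ (k : ℕ) (a b), a ∈ A → b ∈ Y →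
      c - ε k * ρ ^ 2 ≤ penObj f g xb yb k (ε k) (a, b) →
      (k : ℝ) * S (a, b) ≤ 2 * (B - c + ρ ^ 2) := fun k a b ha hb h => by
    have h1 := hB' a ha b hb
    have h2 : 0 ≤ ε k * ‖b - yb‖ ^ 2 := mul_nonneg (hεpos k).le (sq_nonneg _)
    have h3 : ε k * ρ ^ 2 ≤ ρ ^ 2 := by nlinarith [hε1 k, sq_nonneg ρ]
    simp only [penObj] at h
    simp only [hS]
    linarith
  have hup : ∀ (k : ℕ) a b, penObj f g xb yb k (ε k) (a, b) ≤ f a b + ‖a - xb‖ ^ 2 :=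
    fun k a b => by
    have h1 := mul_nonneg (Nat.cast_nonneg (α := ℝ) k) (hSpos (a, b))
    have h2 : 0 ≤ ε k * ‖b - yb‖ ^ 2 := mul_nonneg (hεpos k).le (sq_nonneg _)
    simp only [hS] at h1
    simp only [penObj]
    linarith
  obtain ⟨⟨xs, ys, zs⟩, hsmem, φ, hφ, hlim⟩ := (hAc.prod (hYc.prod hYc)).tendsto_subseq
    (x := fun k => (x k, y k, z k)) (fun k => ⟨hx k, hy k, hzY k⟩)
  have hxl : Tendsto (fun k => x (φ k)) atTop (𝓝 xs) := (continuous_fst.tendsto _).comp hlim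
  have hyl : Tendsto (fun k => y (φ k)) atTop (𝓝 ys) :=
    ((continuous_fst.comp continuous_snd).tendsto _).comp hlim
  have hzl : Tendsto (fun k => z (φ k)) atTop (𝓝 zs) :=
    ((continuous_snd.comp continuous_snd).tendsto _).comp hlim
  have hεl := hε0.comp hφ.tendsto_atTop
  have hgap : ∀ (a : ℕ → EuclideanSpace ℝ (Fin n)) (b : ℕ → EuclideanSpace ℝ (Fin m)) (as bs),
      Tendsto a atTop (𝓝 as) → Tendsto b atTop (𝓝 bs) →
      (∀ k, (φ k : ℝ) * S (a k, b k) ≤ 2 * (B - c + ρ ^ 2)) → bs ∈ Feas g as := by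
    intro a b as bs ha hb h
    refine hfeas _ _ (tendsto_nhds_unique ((hSc.tendsto (as, bs)).comp (ha.prodMk_nhds hb)) ?_)
    have hz : Tendsto (fun k : ℕ => (2 * (B - c + ρ ^ 2)) / (φ k : ℝ)) atTop (𝓝 0) :=
      (tendsto_const_div_atTop_nhds_zero_nat _).comp hφ.tendsto_atTop
    refine tendsto_of_tendsto_of_tendsto_of_le_of_le' tendsto_const_nhds hz
      (Eventually.of_forall fun k => hSpos _) ?_
    filter_upwards [eventually_gt_atTop 0] with k hk
    have hk' : (0 : ℝ) < φ k := Nat.cast_pos.2 (hk.trans_le hφ.le_apply)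
    rw [le_div_iff₀ hk', mul_comm]
    exact h k
  have hysF : ys ∈ Feas g xs := hgap _ _ _ _ hxl hyl fun k =>
    hpen _ _ _ (hx _) (hy _) (by nlinarith [hlow (φ k), sq_nonneg ‖x (φ k) - xb‖])
  have hzsF : zs ∈ Feas g xb := hgap _ _ _ _ tendsto_const_nhds hzl fun k =>
    hpen _ _ _ hxA (hzY _) (by nlinarith [hlow (φ k), hz (φ k), sq_nonneg ‖x (φ k) - xb‖])
  have hleft : Tendsto (fun k => c - ε (φ k) * ρ ^ 2 + ‖x (φ k) - xb‖ ^ 2) atTop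
      (𝓝 (c + ‖xs - xb‖ ^ 2)) := by
    have := (tendsto_const_nhds (x := c)).sub (hεl.mul_const (ρ ^ 2))
    rw [zero_mul, sub_zero] at this
    exact this.add ((hxl.sub_const xb).norm.pow 2)
  have hxs : xs = xb := by
    have h1 : c + ‖xs - xb‖ ^ 2 ≤ f xb zs := by
      refine le_of_tendsto_of_tendsto' hleft
        ((hfc.tendsto (xb, zs)).comp (tendsto_const_nhds.prodMk_nhds hzl)) fun k => ?_
      have := hup (φ k) xb (z (φ k))
      rw [sub_self, norm_zero, zero_pow two_ne_zero, add_zero] at this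
      exact ((hlow (φ k)).trans (hz (φ k))).trans this
    have h2 := hub zs hzsF
    have h3 : ‖xs - xb‖ ^ 2 = 0 := le_antisymm (by linarith) (sq_nonneg _)
    rwa [sq_eq_zero_iff, norm_eq_zero, sub_eq_zero] at h3
  have hys : c + ‖xs - xb‖ ^ 2 ≤ f xs ys + ‖xs - xb‖ ^ 2 :=
    le_of_tendsto_of_tendsto' hleft
      (((hfc.tendsto (xs, ys)).comp (hxl.prodMk_nhds hyl)).add ((hxl.sub_const xb).norm.pow 2))
      fun k => (hlow (φ k)).trans (hup (φ k) _ _)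
  rw [hxs] at hysF hys hxl
  refine ⟨fun k => φ k, fun k => ε (φ k), fun k => x (φ k), fun k => y (φ k), ys,
    fun k => Nat.cast_nonneg _, fun k => hεpos _, hεl, fun k => (hx _).1, fun k => hy _, hxl, hyl,
    hsmem.2.1, hysF, le_antisymm (hub ys hysF) (by linarith), fun k => hymax _, ?_⟩
  filter_upwards [hxl.eventually (ball_mem_nhds _ hr)] with k hk
  filter_upwards [mem_nhdsWithin_of_mem_nhds (isOpen_ball.mem_nhds hk), self_mem_nhdsWithin]
    with v hv hvX
  exact hxmin (φ k) v ⟨hvX, ball_subset_closedBall hv⟩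

end Penalty

section MFCQCase

variable {n m q : ℕ} {f : EuclideanSpace ℝ (Fin n) → EuclideanSpace ℝ (Fin m) → ℝ}
  {g : EuclideanSpace ℝ (Fin n) → EuclideanSpace ℝ (Fin m) → Fin q → ℝ}

/-- Restricted sup-compactness at a local minimizer of the value function provides, near the
minimizer, solutions of the lower level problem in a fixed ball centred at a solution. -/
theorem RestrictedSupCompact.exists_closedBall {X : Set (EuclideanSpace ℝ (Fin n))}
    {xb : EuclideanSpace ℝ (Fin n)} (hmin : IsLocalMinOn (Vfun f g) X xb)
    (hrsc : RestrictedSupCompact f g xb) :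
    ∃ yb ∈ Sol f g xb, ∃ r ρ : ℝ, 0 < r ∧ 0 < ρ ∧ ∀ x ∈ X ∩ closedBall xb r,
      ∃ y ∈ closedBall yb ρ, y ∈ Feas g x ∧ f xb yb ≤ f x y := by
  obtain ⟨⟨c, hc⟩, ε, δ, hε, hδ, Ω, hΩ, hsol⟩ := hrsc
  have hlt : Vfun f g xb - (ε : EReal) < Vfun f g xb := by
    rw [hc, ← EReal.coe_sub, EReal.coe_lt_coe_iff]
    linarith
  obtain ⟨yb, hyb, -⟩ := hsol xb (by simpa using hδ) hlt
  obtain ⟨ρ, hρ, hball⟩ := hΩ.isBounded.subset_closedBall_lt 0 yb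
  obtain ⟨r, hr, hloc⟩ := Metric.eventually_nhds_iff.1 (eventually_nhdsWithin_iff.1 hmin)
  refine ⟨yb, hyb, min r δ / 2, ρ, by positivity, hρ, fun x hx => ?_⟩
  have hd : dist x xb < min r δ :=
    (mem_closedBall.1 hx.2).trans_lt (half_lt_self (lt_min hr hδ))
  have hle : Vfun f g xb ≤ Vfun f g x := hloc (hd.trans_le (min_le_left _ _)) hx.1
  obtain ⟨y, hy, hyΩ⟩ := hsol x (by rw [← dist_eq_norm]; exact hd.trans_le (min_le_right _ _))
    (hlt.trans_le hle)
  refine ⟨y, hball hyΩ, hy.1, ?_⟩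
  rwa [← hyb.2, ← hy.2, EReal.coe_le_coe_iff] at hle

/-- Necessary optimality condition for minimizers of the value function when the lower level
problem satisfies the Mangasarian-Fromovitz constraint qualification. -/
theorem exists_stationary_of_MFCQ
    {X : Set (EuclideanSpace ℝ (Fin n))} (hXc : IsClosed X)
    (hf : ContDiff ℝ 2 (fun p : EuclideanSpace ℝ (Fin n) × EuclideanSpace ℝ (Fin m) => f p.1 p.2))
    (hg : ∀ i, ContDiff ℝ 2
      (fun p : EuclideanSpace ℝ (Fin n) × EuclideanSpace ℝ (Fin m) => g p.1 p.2 i))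
    (hconv : ∀ x ∈ X, ConcaveOn ℝ Set.univ (f x) ∧ ∀ i, ConvexOn ℝ Set.univ (fun y => g x y i))
    {xb : EuclideanSpace ℝ (Fin n)} (hxbX : xb ∈ X) (hmin : IsLocalMinOn (Vfun f g) X xb)
    (hrsc : RestrictedSupCompact f g xb) (hMF : ∀ y ∈ Sol f g xb, MFCQy g xb y) :
    ∃ ys ∈ Sol f g xb, ∃ lam ∈ SigmaSet f g xb ys, -gradxL f g xb ys lam ∈ limNC X xb := by
  obtain ⟨yb, hyb, r, ρ, hr, hρ, hV⟩ := hrsc.exists_closedBall hmin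
  have hub : ∀ y ∈ Feas g xb, f xb y ≤ f xb yb := fun y hy => by
    rw [← EReal.coe_le_coe_iff, hyb.2]
    exact le_sSup ⟨y, hy, rfl⟩
  obtain ⟨K, ε, x, y, ys, hK, hε, hε0, hxX, hyY, hx, hy, -, hysF, hysc, hymax, hxmin⟩ :=
    exists_penObj_minimax_seq hf hg hXc hxbX hr hρ hV hub
  have hfc := hf.continuous
  have hgc := fun i => (hg i).continuous
  set lam : ℕ → Fin q → ℝ := fun k => penMult g (K k) (x k) (y k) with hlam
  have hlampos : ∀ k i, 0 ≤ lam k i := fun k i => mul_nonneg (hK k) (le_max_right _ _)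
  set t : ℕ → ℝ := fun k => (1 + ∑ i, lam k i)⁻¹ with ht
  have hden : ∀ k, 0 < 1 + ∑ i, lam k i := fun k => by
    have := Finset.sum_nonneg fun i (_ : i ∈ Finset.univ) => hlampos k i
    linarith
  have htpos : ∀ k, 0 < t k := fun k => inv_pos.2 (hden k)
  have htsum : ∀ k, t k + ∑ i, t k * lam k i = 1 := fun k => by
    rw [← Finset.mul_sum, ← mul_one_add]
    exact inv_mul_cancel₀ (hden k).ne'
  have hmupos : ∀ k i, 0 ≤ t k * lam k i := fun k i => mul_nonneg (htpos k).le (hlampos k i)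
  have hbd : ∀ k, (t k, t k • lam k) ∈ Set.Icc (0 : ℝ) 1 ×ˢ Set.Icc (0 : Fin q → ℝ) 1 := by
    intro k
    have h1 := htsum k
    refine ⟨⟨(htpos k).le, ?_⟩, fun i => hmupos k i, fun i => ?_⟩
    · have := Finset.sum_nonneg fun i (_ : i ∈ Finset.univ) => hmupos k i
      linarith
    · have := Finset.single_le_sum (fun i _ => hmupos k i) (Finset.mem_univ i)
      have h2 := htpos k
      simp only [Pi.smul_apply, smul_eq_mul, Pi.one_apply]
      linarith
  obtain ⟨⟨tb, mu⟩, hb, φ, hφ, hlim⟩ :=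
    (isCompact_Icc.prod isCompact_Icc).tendsto_subseq hbd
  have htl : Tendsto (fun k => t (φ k)) atTop (𝓝 tb) := (continuous_fst.tendsto _).comp hlim
  have hmul : Tendsto (fun k => t (φ k) • lam (φ k)) atTop (𝓝 mu) :=
    (continuous_snd.tendsto _).comp hlim
  have hmuli : ∀ i, Tendsto (fun k => t (φ k) * lam (φ k) i) atTop (𝓝 (mu i)) := fun i =>
    ((continuous_apply i).tendsto _).comp hmul
  have hxl := hx.comp hφ.tendsto_atTop
  have hyl := hy.comp hφ.tendsto_atTop
  have hεl := hε0.comp hφ.tendsto_atTop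
  have hmupos' : ∀ i, 0 ≤ mu i := fun i => hb.2.1 i
  have hsum : tb + ∑ i, mu i = 1 :=
    tendsto_nhds_unique (htl.add (tendsto_finsetSum _ fun i _ => hmuli i))
      (by simp only [htsum]; exact tendsto_const_nhds)
  have hcomp : ∀ i, mu i * g xb ys i = 0 := fun i => by
    rcases (hysF i).eq_or_lt with h | h
    · rw [h, mul_zero]
    · have h1 : ∀ᶠ k in atTop, g (x (φ k)) (y (φ k)) i < 0 :=
        (((hgc i).tendsto (xb, ys)).comp (hxl.prodMk_nhds hyl)).eventually_lt_const h
      have h2 : mu i = 0 := by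
        refine tendsto_nhds_unique (hmuli i) (tendsto_const_nhds.congr' ?_)
        filter_upwards [h1] with k hk
        simp only [hlam, penMult]
        rw [max_eq_right hk.le, mul_zero, mul_zero]
      rw [h2, zero_mul]
  set N : EuclideanSpace ℝ (Fin m) → ℝ := fun z => tb * f xb z - ∑ i, mu i * g xb z i with hN
  have hNmax : ∀ z ∈ closedBall yb ρ, N z ≤ N ys := by
    intro z hz
    have hk : ∀ k, t k * f (x k) z - ∑ i, (t k * lam k i) * g (x k) z i -
        t k * (ε k * ‖z - yb‖ ^ 2) ≤ t k * f (x k) (y k) -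
        ∑ i, (t k * lam k i) * g (x k) (y k) i - t k * (ε k * ‖y k - yb‖ ^ 2) := by
      intro k
      have hc1 := concaveOn_Lag (hconv _ (hxX k)).1 (hconv _ (hxX k)).2 zero_le_one (hlampos k)
      have hc2 : ConvexOn ℝ Set.univ fun z : EuclideanSpace ℝ (Fin m) => ε k * ‖z - yb‖ ^ 2 := by
        have h1 := ((convexOn_dist yb convex_univ).pow (fun _ _ => dist_nonneg) 2).smul (hε k).le
        simpa [dist_eq_norm] using h1
      have h1 := concave_le_of_isMax (convex_closedBall yb ρ) (hc1.sub hc2) (hyY k)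
        (φ := fun z => penObj f g xb yb (K k) (ε k) (x k, z))
        (eventually_nhdsWithin_of_forall (hymax k))
        (hasFDerivAt_scaled_Lag_sub_penObj hg xb yb (K k) (ε k) (x k) (y k)) z hz
      have h2 := mul_le_mul_of_nonneg_left h1 (htpos k).le
      simpa only [Pi.sub_apply, one_mul, mul_sub, Finset.mul_sum, mul_assoc] using h2
    have hl : ∀ (w : ℕ → EuclideanSpace ℝ (Fin m)) (ws), Tendsto w atTop (𝓝 ws) →
        Tendsto (fun k => t (φ k) * f (x (φ k)) (w k) -
          ∑ i, (t (φ k) * lam (φ k) i) * g (x (φ k)) (w k) i -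
          t (φ k) * (ε (φ k) * ‖w k - yb‖ ^ 2)) atTop (𝓝 (N ws)) := by
      intro w ws hw
      have h1 := htl.mul ((hfc.tendsto (xb, ws)).comp (hxl.prodMk_nhds hw))
      have h2 := tendsto_finsetSum Finset.univ fun i _ =>
        (hmuli i).mul (((hgc i).tendsto (xb, ws)).comp (hxl.prodMk_nhds hw))
      have h3 := htl.mul (hεl.mul ((hw.sub_const yb).norm.pow 2))
      have h4 := (h1.sub h2).sub h3
      rw [zero_mul, mul_zero, sub_zero] at h4
      exact h4
    exact le_of_tendsto_of_tendsto' (hl _ _ tendsto_const_nhds) (hl _ _ hyl) fun k => hk (φ k)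
  have hNys : N ys = tb * f xb yb := by
    simp only [hN, hysc, hcomp, Finset.sum_const_zero, sub_zero]
  have hterm : ∀ i ∈ Finset.univ, mu i * g xb yb i ≤ 0 := fun i _ =>
    mul_nonpos_of_nonneg_of_nonpos (hmupos' i) (hyb.1 i)
  have hcompb : ∑ i, mu i * g xb yb i = 0 := by
    refine le_antisymm (Finset.sum_nonpos hterm) ?_
    have := hNmax yb (mem_closedBall_self hρ.le)
    rw [hNys] at this
    simp only [hN] at this
    linarith
  have hNyb : N yb = N ys := by
    rw [hNys]
    simp only [hN, hcompb, sub_zero]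
  have hcrit : ∀ z, IsLocalMax N z →
      tb • grady f xb z - ∑ i, mu i • grady (fun x y => g x y i) xb z = 0 := fun z hz => by
    have := hz.hasFDerivAt_eq_zero (hasFDerivAt_scaled_Lag hf hg xb z tb mu)
    exact (map_eq_zero_iff _ (InnerProductSpace.toDual ℝ _).injective).1 this
  have hybmax : IsLocalMax N yb := by
    filter_upwards [ball_mem_nhds yb hρ] with z hz
    rw [hNyb]
    exact hNmax z (ball_subset_closedBall hz)
  have hcritb := hcrit yb hybmax
  have htb : 0 < tb := by
    refine (hb.1.1 : (0 : ℝ) ≤ tb).lt_of_ne fun h0 => ?_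
    have h0' : tb = 0 := h0.symm
    rw [h0', zero_smul, zero_sub, neg_eq_zero] at hcritb
    have := hMF yb hyb mu hmupos' hcompb hyb.1 hcritb
    simp [h0', this] at hsum
  have hysmax : IsLocalMax N ys := Eventually.of_forall fun z => by
    have h1 := hasFDerivAt_scaled_Lag hf hg xb yb tb mu
    rw [hcritb, map_zero] at h1
    rw [← hNyb]
    exact concave_le_of_hasFDerivAt_zero
      (concaveOn_Lag (hconv _ hxbX).1 (hconv _ hxbX).2 htb.le hmupos') h1 z
  have hlaml : Tendsto (fun k => lam (φ k)) atTop (𝓝 (tb⁻¹ • mu)) := by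
    refine ((htl.inv₀ htb.ne').smul hmul).congr fun k => ?_
    rw [inv_smul_smul₀ (htpos _).ne']
  refine ⟨ys, ⟨hysF, by rw [hysc, hyb.2]⟩, tb⁻¹ • mu,
    ⟨?_, fun i => mul_nonneg (inv_nonneg.2 htb.le) (hmupos' i), hysF, ?_⟩, ?_⟩
  · have h1 := congrArg (fun v => tb⁻¹ • v) (hcrit ys hysmax)
    simp only [smul_sub, smul_zero, inv_smul_smul₀ htb.ne', Finset.smul_sum, smul_smul] at h1
    rw [gradyL_eq hf hg]
    simpa only [Pi.smul_apply, smul_eq_mul] using h1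
  · simp [mul_assoc, hcomp]
  · have hreg : ∀ᶠ k in atTop,
        -(gradxL f g (x k) (y k) (lam k) + (2 : ℝ) • (x k - xb)) ∈ regNC X (x k) := by
      filter_upwards [hxmin] with k hk
      obtain ⟨φ', h1, h2⟩ := exists_hasStrictFDerivAt_penObj hf hg xb yb (K k) (ε k) (x k) (y k)
      exact neg_mem_regNC_of_unique_max (isCompact_closedBall yb ρ)
        (continuous_penObj hf hg xb yb (K k) (ε k)) h1 h2
        (fun z hz hne => penObj_lt_of_isMax (hconv _ (hxX k)).1 (hconv _ (hxX k)).2 (hK k) (hε k)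
          (convex_closedBall yb ρ) (hyY k) (hymax k) hz hne) hk
    have hcont : Continuous fun w : EuclideanSpace ℝ (Fin n) × EuclideanSpace ℝ (Fin m) ×
        (Fin q → ℝ) => gradxL f g w.1 w.2.1 w.2.2 := by
      simp only [gradxL_eq hf hg]
      have h1 := (contDiff_gradx hf).continuous
      have h2 := fun i => (contDiff_gradx (f := fun x y => g x y i) (hg i)).continuous
      have h3 : Continuous fun w : EuclideanSpace ℝ (Fin n) × EuclideanSpace ℝ (Fin m) ×
        (Fin q → ℝ) => (w.1, w.2.1) := by fun_prop
      have h4 : ∀ i, Continuous fun w : EuclideanSpace ℝ (Fin n) × EuclideanSpace ℝ (Fin m) ×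
        (Fin q → ℝ) => w.2.2 i := fun i => by fun_prop
      exact (h1.comp h3).sub (continuous_finsetSum _ fun i _ => (h4 i).smul ((h2 i).comp h3))
    refine limNC_of_eventually (Eventually.of_forall fun k => hxX (φ k))
      (hφ.tendsto_atTop.eventually hreg) hxl ?_
    have h1 := (hcont.tendsto (xb, ys, tb⁻¹ • mu)).comp
      (hxl.prodMk_nhds (hyl.prodMk_nhds hlaml))
    have h2 := (h1.add ((hxl.sub_const xb).const_smul (2 : ℝ))).neg
    rw [sub_self, smul_zero, add_zero] at h2
    exact h2

end MFCQCase

/-- Theorem 4.4 — necessary optimality condition at a boundary point via the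
Wolfe duality approach. -/
theorem stmt16 {n m q : ℕ}
    (f : EuclideanSpace ℝ (Fin n) → EuclideanSpace ℝ (Fin m) → ℝ)
    (g : EuclideanSpace ℝ (Fin n) → EuclideanSpace ℝ (Fin m) → Fin q → ℝ)
    (X : Set (EuclideanSpace ℝ (Fin n))) (hXc : IsClosed X)
    (hf : ContDiff ℝ 2 (fun p : EuclideanSpace ℝ (Fin n) × EuclideanSpace ℝ (Fin m) => f p.1 p.2))
    (hg : ∀ i, ContDiff ℝ 2
      (fun p : EuclideanSpace ℝ (Fin n) × EuclideanSpace ℝ (Fin m) => g p.1 p.2 i))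
    (hconv : ∀ x ∈ X, ConcaveOn ℝ Set.univ (f x) ∧ ∀ i, ConvexOn ℝ Set.univ (fun y => g x y i))
    (xb : EuclideanSpace ℝ (Fin n)) (hbdy : xb ∈ frontier X) (hxbX : xb ∈ X)
    (hmin : IsLocalMinOn (Vfun f g) X xb)
    (hrsc : RestrictedSupCompact f g xb)
    (halt :
      ((∀ y ∈ Sol f g xb, MFCQy g xb y) ∧
        (∀ y ∈ Sol f g xb, ∀ lam ∈ SigmaSet f g xb y,
          StableCQ (WolfeG n m q) (WolfeH f g) (xb, y, lam))) ∨
      ((∃ y ∈ Sol f g xb, RobinsonStability g xb y) ∧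
        (∀ y ∈ Sol f g xb, StableParamCQ f g xb y) ∧
        (∀ y ∈ Sol f g xb, ∀ lam ∈ SigmaSet f g xb y,
          StableCQ (WolfeG n m q) (WolfeH f g) (xb, y, lam)) ∧
        {v | ∃ y ∈ Sol f g xb, ∃ lam ∈ SigmaSet f g xb y,
          ∃ u : EuclideanSpace ℝ (Fin m), hessyyLu f g xb y lam u = 0 ∧
            (∀ i, 0 ≤ -(gyTu g xb y u i)) ∧ (∑ i, lam i * gyTu g xb y u i = 0) ∧
            v = hessxyLu f g xb y lam u} = {0})) :
    ∃ yb ∈ Sol f g xb, ∃ lamb ∈ SigmaSet f g xb yb, ∃ u : EuclideanSpace ℝ (Fin m),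
      -(gradxL f g xb yb lamb + hessxyLu f g xb yb lamb u) ∈ limNC X xb ∧
      gradyL f g xb yb lamb = 0 ∧
      hessyyLu f g xb yb lamb u = 0 ∧
      (∀ i, 0 ≤ -(gyTu g xb yb u i) - g xb yb i) ∧ (∀ i, 0 ≤ lamb i) ∧
      ∑ i, lamb i * (-(gyTu g xb yb u i) - g xb yb i) = 0 ∧
      (∀ i, 0 ≤ -(g xb yb i)) ∧ ∑ i, lamb i * g xb yb i = 0 := by
  rcases halt with ⟨hMF, -⟩ | ⟨-, -, hCQ, hset⟩
  · obtain ⟨ys, hys, lam, hlam, hN⟩ :=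
      exists_stationary_of_MFCQ hXc hf hg hconv hxbX hmin hrsc hMF
    obtain ⟨h1, h2, h3, h4⟩ := hlam
    refine ⟨ys, hys, lam, ⟨h1, h2, h3, h4⟩, 0, ?_, h1, ?_, ?_, h2, ?_, ?_, h4⟩
    · simpa [hessxyLu, gradient] using hN
    · simp [hessyyLu, gradient]
    · simpa [gyTu] using h3
    · simpa [gyTu] using h4
    · simpa using h3
  · have h0 : (0 : EuclideanSpace ℝ (Fin n)) ∈ ({0} : Set (EuclideanSpace ℝ (Fin n))) := rfl
    rw [← hset] at h0
    obtain ⟨yb, hyb, lam, hlam, -⟩ := h0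
    have hqual : ∀ u, hessyyLu f g xb yb lam u = 0 → (∀ i, 0 ≤ -(gyTu g xb yb u i)) →
        ∑ i, lam i * gyTu g xb yb u i = 0 → hessxyLu f g xb yb lam u = 0 := fun u h1 h2 h3 =>
      Set.mem_singleton_iff.1 (hset ▸ ⟨yb, hyb, lam, hlam, u, h1, h2, h3, rfl⟩)
    obtain ⟨u, h1, h2, h3, h4⟩ := exists_stationary_of_stableCQ hXc hf hg hconv hxbX hmin hyb hlam
      (hCQ yb hyb lam hlam) hqual
    exact ⟨yb, hyb, lam, hlam, u, h1, hlam.1, h2, h3, hlam.2.1, h4,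
      fun i => neg_nonneg.2 (hlam.2.2.1 i), hlam.2.2.2⟩
end

section
/- Assume f, g are twice continuously differentiable and X ⊆ ℝⁿ is closed. Let x̄ ∈ X, ȳ ∈ S(x̄), λ̄ ∈ Σ(x̄,ȳ), and suppose there exists ū ∈ ℝᵐ such that: 0 ∈ ∇_x L(x̄,ȳ,λ̄) + ∇²_{xy}L(x̄,ȳ,λ̄)ū + N_X(x̄); ∇_y L(x̄,ȳ,λ̄) = 0; ∇²_{yy}L(x̄,ȳ,λ̄)ū = 0; −∇_y g(x̄,ȳ)ᵀū − g(x̄,ȳ) ≥ 0, λ̄ ≥ 0, λ̄ᵀ(−∇_y g(x̄,ȳ)ᵀū − g(x̄,ȳ)) = 0; and −g(x̄,ȳ) ≥ 0, λ̄ᵀg(x̄,ȳ) = 0. Then (x̄,ȳ,λ̄) is an S-stationary point of (P_MPEC). -/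
open Filter Topology Metric RealInnerProductSpace

/-- The gradient of `φ - ∑ i, c i * ψ i` at a point of differentiability. -/
theorem gradient_sub_sum_const_mul {F ι : Type*} [NormedAddCommGroup F] [InnerProductSpace ℝ F]
    [CompleteSpace F] [Fintype ι] {φ : F → ℝ} {ψ : ι → F → ℝ} (c : ι → ℝ) {x : F}
    (hφ : DifferentiableAt ℝ φ x) (hψ : ∀ i, DifferentiableAt ℝ (ψ i) x) :
    gradient (fun z => φ z - ∑ i, c i * ψ i z) x =
      gradient φ x - ∑ i, c i • gradient (ψ i) x := by
  refine HasGradientAt.gradient ?_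
  rw [hasGradientAt_iff_hasFDerivAt]
  simp only [map_sub, map_sum, map_smul]
  exact (hasGradientAt_iff_hasFDerivAt.mp hφ.hasGradientAt).sub
    (HasFDerivAt.fun_sum fun i _ =>
      (hasGradientAt_iff_hasFDerivAt.mp (hψ i).hasGradientAt).const_mul (c i))

/-- Theorem 4.5 — the Wolfe-duality stationarity system implies S-stationarity
of the MPEC reformulation. -/
theorem stmt17 {n m q : ℕ}
    (f : EuclideanSpace ℝ (Fin n) → EuclideanSpace ℝ (Fin m) → ℝ)
    (g : EuclideanSpace ℝ (Fin n) → EuclideanSpace ℝ (Fin m) → Fin q → ℝ)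
    (X : Set (EuclideanSpace ℝ (Fin n))) (hXc : IsClosed X)
    (hf : ContDiff ℝ 2 (fun p : EuclideanSpace ℝ (Fin n) × EuclideanSpace ℝ (Fin m) => f p.1 p.2))
    (hg : ∀ i, ContDiff ℝ 2
      (fun p : EuclideanSpace ℝ (Fin n) × EuclideanSpace ℝ (Fin m) => g p.1 p.2 i))
    (xb : EuclideanSpace ℝ (Fin n)) (hxbX : xb ∈ X)
    (yb : EuclideanSpace ℝ (Fin m)) (hyb : yb ∈ Sol f g xb)
    (lamb : Fin q → ℝ) (hlamb : lamb ∈ SigmaSet f g xb yb)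
    (hsys : ∃ u : EuclideanSpace ℝ (Fin m),
      -(gradxL f g xb yb lamb + hessxyLu f g xb yb lamb u) ∈ limNC X xb ∧
      gradyL f g xb yb lamb = 0 ∧
      hessyyLu f g xb yb lamb u = 0 ∧
      (∀ i, 0 ≤ -(gyTu g xb yb u i) - g xb yb i) ∧ (∀ i, 0 ≤ lamb i) ∧
      ∑ i, lamb i * (-(gyTu g xb yb u i) - g xb yb i) = 0 ∧
      (∀ i, 0 ≤ -(g xb yb i)) ∧ ∑ i, lamb i * g xb yb i = 0) :
    SStationary f g X xb yb lamb := by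
  obtain ⟨u, hx, hy, hyy, hβ, hlam, hcompl, -, -⟩ := hsys
  have hfx : DifferentiableAt ℝ (fun x => f x yb) xb :=
    ((hf.differentiable (by norm_num)).comp (by fun_prop :
      Differentiable ℝ fun x : EuclideanSpace ℝ (Fin n) => (x, yb))).differentiableAt
  have hfy : DifferentiableAt ℝ (fun y => f xb y) yb :=
    ((hf.differentiable (by norm_num)).comp (by fun_prop :
      Differentiable ℝ fun y : EuclideanSpace ℝ (Fin m) => (xb, y))).differentiableAt
  have hgx (i : Fin q) : DifferentiableAt ℝ (fun x => g x yb i) xb :=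
    (((hg i).differentiable (by norm_num)).comp (by fun_prop :
      Differentiable ℝ fun x : EuclideanSpace ℝ (Fin n) => (x, yb))).differentiableAt
  have hgy (i : Fin q) : DifferentiableAt ℝ (fun y => g xb y i) yb :=
    (((hg i).differentiable (by norm_num)).comp (by fun_prop :
      Differentiable ℝ fun y : EuclideanSpace ℝ (Fin m) => (xb, y))).differentiableAt
  have hLx : gradxL f g xb yb lamb =
      gradx f xb yb - ∑ i, lamb i • gradx (fun x y => g x y i) xb yb :=
    gradient_sub_sum_const_mul lamb hfx hgx
  have hLy : gradyL f g xb yb lamb =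
      grady f xb yb - ∑ i, lamb i • grady (fun x y => g x y i) xb yb :=
    gradient_sub_sum_const_mul lamb hfy hgy
  have hterm (i : Fin q) : lamb i * (-(gyTu g xb yb u i) - g xb yb i) = 0 :=
    (Finset.sum_eq_zero_iff_of_nonneg fun i _ => mul_nonneg (hlam i) (hβ i)).mp hcompl i
      (Finset.mem_univ i)
  refine ⟨u, fun i => -lamb i, fun i => -(gyTu g xb yb u i), ?_, ?_, fun i => sub_self _,
    fun i _ hi => by simp [hi], fun i hgi hi => ?_, fun i hgi hi => ⟨by simp [hi], ?_⟩⟩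
  · simpa only [hLx, neg_smul, Finset.sum_neg_distrib, ← sub_eq_add_neg] using hx
  · rw [hyy, add_zero, ← hy, hLy]
    simp only [neg_smul, Finset.sum_neg_distrib, ← sub_eq_add_neg]
  · simpa [hgi, hi.ne'] using hterm i
  · simpa [hgi] using hβ i
end
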